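/- arXiv:2301.00569 — 5 statements merged into one kernel-verified Lean document; each statement's English description precedes it below -/
import Mathlib

section
/- Let (R, m) be a one-dimensional Cohen-Macaulay local ring, I an m-primary ideal, and x ∈ m a non-zerodivisor. Then type(I) = type(R/I) if and only if xI : m ⊆ (x). -/
open CategoryTheory IsLocalRing

universe u

/-- The length of a module, as the Krull dimension of its submodule lattice. -/
noncomputable def rlength (R : Type u) (M : Type*) [Ring R] [AddCommGroup M]
    [Module R M] : WithBot ℕ∞ :=
  Order.krullDim (Submodule R M)

/-- `dim_k Ext^1_R(k, M)` (measured as `R`-length, which agrees with `k`-dimension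
since the module is killed by the maximal ideal). -/
noncomputable def modType (R : Type u) [CommRing R] [IsLocalRing R]
    (M : ModuleCat.{u} R) : WithBot ℕ∞ :=
  rlength R (((_root_.Ext R (ModuleCat.{u} R) 1).obj
    (Opposite.op (ModuleCat.of R (ResidueField R)))).obj M)

/-- The Cohen–Macaulay type of an `m`-primary ideal `I`:  `dim_k Ext^1_R(k, I)`. -/
noncomputable def idealType (R : Type u) [CommRing R] [IsLocalRing R] (I : Ideal R) :
    WithBot ℕ∞ :=
  modType R (ModuleCat.of R I)

/-- The Cohen–Macaulay type of `R/I`: `dim_k Hom_R(k, R/I)`. -/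
noncomputable def quotType (R : Type u) [CommRing R] [IsLocalRing R] (I : Ideal R) :
    WithBot ℕ∞ :=
  rlength R (ResidueField R →ₗ[R] R ⧸ I)

/-- An ideal is `m`-primary iff its radical is the maximal ideal. -/
def IsMPrimary (R : Type u) [CommRing R] [IsLocalRing R] (I : Ideal R) : Prop :=
  I.radical = maximalIdeal R

/-- `I` is Elias if `type(I) = type(R/I)`. -/
def EliasIdeal (R : Type u) [CommRing R] [IsLocalRing R] (I : Ideal R) : Prop :=
  idealType R I = quotType R I

/-- The minimal number of generators, as `dim_k I/mI`. -/
noncomputable def mu (R : Type u) [CommRing R] [IsLocalRing R] (I : Ideal R) :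
    WithBot ℕ∞ :=
  rlength R (I ⧸ (maximalIdeal R • ⊤ : Submodule R I))

/-- `R` has Hilbert–Samuel multiplicity `e`. -/
def HasMultiplicity (R : Type u) [CommRing R] [IsLocalRing R] (e : ℕ) : Prop :=
  ∃ N : ℕ, ∀ n ≥ N,
    rlength R (R ⧸ (maximalIdeal R) ^ (n + 1)) =
      rlength R (R ⧸ (maximalIdeal R) ^ n) + (e : WithBot ℕ∞)

theorem CategoryTheory.ShortComplex.nonempty_homology_linearEquiv {R : Type u} [CommRing R]
    (S : ShortComplex (ModuleCat.{u} R)) {D E : Type*} [AddCommGroup D] [Module R D]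
    [AddCommGroup E] [Module R E] (Ψ : S.X₂ →ₗ[R] D) (Θ : E →ₗ[R] D)
    (hΘ : Function.Injective Θ)
    (hker : ∀ f, S.g.hom f = 0 → (Ψ f = 0 ↔ ∃ a, S.f.hom a = f))
    (hmem : ∀ f, S.g.hom f = 0 → ∃ e, Θ e = Ψ f)
    (hsurj : ∀ e, ∃ f, S.g.hom f = 0 ∧ Ψ f = Θ e) :
    Nonempty (S.homology ≃ₗ[R] E) := by
  let Ψ' : LinearMap.ker S.g.hom →ₗ[R] D := Ψ ∘ₗ Submodule.subtype _
  have h₁ : LinearMap.range S.moduleCatToCycles = LinearMap.ker Ψ' := by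
    ext ⟨f, hf⟩
    have := hker f hf
    simp only [LinearMap.mem_range, LinearMap.mem_ker]
    refine Iff.trans ?_ this.symm
    exact exists_congr fun a => Subtype.ext_iff
  have h₂ : LinearMap.range Ψ' = LinearMap.range Θ := by
    apply le_antisymm
    · rintro _ ⟨⟨f, hf⟩, rfl⟩
      exact hmem f hf
    · rintro _ ⟨e, rfl⟩
      obtain ⟨f, hf, h⟩ := hsurj e
      exact ⟨⟨f, hf⟩, h⟩
  exact ⟨S.moduleCatHomologyIso.toLinearEquiv ≪≫ₗ Submodule.quotEquivOfEq _ _ h₁ ≪≫ₗ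
    Ψ'.quotKerEquivRange ≪≫ₗ LinearEquiv.ofEq _ _ h₂ ≪≫ₗ (LinearEquiv.ofInjective Θ hΘ).symm⟩

/-- The Rees isomorphism in degree one: if `x` kills `M` and is regular on `Y`, then
`Ext¹(M, Y) ≃ Hom(M, Y/xY)`. -/
theorem nonempty_ext_one_linearEquiv {R : Type u} [CommRing R] (M Y : Type u)
    [AddCommGroup M] [Module R M] [AddCommGroup Y] [Module R Y] (x : R)
    (hM : ∀ m : M, x • m = 0) (hY : IsSMulRegular Y x) :
    Nonempty (((_root_.Ext R (ModuleCat.{u} R) 1).obj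
      (Opposite.op (ModuleCat.of R M))).obj (ModuleCat.of R Y) ≃ₗ[R]
        (M →ₗ[R] QuotSMulTop x Y)) := by
  let P := projectiveResolution (ModuleCat.of R M)
  let K := P.complex.linearYonedaObj R (ModuleCat.of R Y)
  let e₁ := (P.isoExt (R := R) 1 (ModuleCat.of R Y)).toLinearEquiv
  let e₂ := (ShortComplex.homologyMapIso (K.isoSc' 0 1 2 (by simp) (by simp))).toLinearEquiv
  let d₁ : P.complex.X 1 →ₗ[R] P.complex.X 0 := (P.complex.d 1 0).hom
  let d₂ : P.complex.X 2 →ₗ[R] P.complex.X 1 := (P.complex.d 2 1).hom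
  let ε : P.complex.X 0 →ₗ[R] M := (P.π.f 0).hom
  have hd : LinearMap.range d₂ = LinearMap.ker d₁ := (P.exact_succ 0).moduleCat_range_eq_ker
  have hε : LinearMap.range d₁ = LinearMap.ker ε := P.exact₀.moduleCat_range_eq_ker
  have hεs : Function.Surjective ε :=
    (ModuleCat.epi_iff_surjective (P.π.f 0)).1 inferInstance
  have hP : Module.Projective R (P.complex.X 0) :=
    (IsProjective.iff_projective (P.complex.X 0)).2 (P.projective 0)
  have hker₁ : ∀ p, d₁ p = 0 → ∃ q, d₂ q = p := fun p hp => by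
    have : p ∈ LinearMap.range d₂ := hd ▸ hp
    exact this
  have hker₀ : ∀ p, ε p = 0 → ∃ q, d₁ q = p := fun p hp => by
    have : p ∈ LinearMap.range d₁ := hε ▸ hp
    exact this
  have hεd : ∀ p, ε (d₁ p) = 0 := fun p => by
    have : d₁ p ∈ LinearMap.ker ε := hε ▸ ⟨p, rfl⟩
    exact this
  have hdd : ∀ p, d₁ (d₂ p) = 0 := fun p => by
    have : d₂ p ∈ LinearMap.ker d₁ := hd ▸ ⟨p, rfl⟩
    exact this
  obtain ⟨h, hh⟩ : ∃ h : P.complex.X 0 →ₗ[R] P.complex.X 1, ∀ p, d₁ (h p) = x • p := by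
    obtain ⟨h, hh⟩ := Module.projective_lifting_property d₁.rangeRestrict
      (LinearMap.codRestrict (LinearMap.range d₁) (x • LinearMap.id)
        (fun p => by
          rw [hε]
          simp [hM])) d₁.surjective_rangeRestrict
    exact ⟨h, fun p => congrArg Subtype.val (LinearMap.congr_fun hh p)⟩
  have hmk : ∀ y : Y, (Submodule.Quotient.mk y : QuotSMulTop x Y) = 0 ↔ ∃ z, x • z = y :=
    fun y => by
      rw [Submodule.Quotient.mk_eq_zero, Submodule.mem_smul_pointwise_iff_exists]
      simp
  have hdiv : ∀ {N : Type u} [AddCommGroup N] [Module R N] (g : N →ₗ[R] Y),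
      (∀ n, (Submodule.Quotient.mk (g n) : QuotSMulTop x Y) = 0) →
      ∃ g' : N →ₗ[R] Y, ∀ n, x • g' n = g n := by
    intro N _ _ g hg
    choose g' hg' using fun n => (hmk (g n)).1 (hg n)
    refine ⟨⟨⟨g', fun a b => hY ?_⟩, fun r a => hY ?_⟩, hg'⟩
    · simp [hg']
    · simp [hg', smul_comm x r]
  let mkY : Y →ₗ[R] QuotSMulTop x Y := Submodule.mkQ _
  let Ψ : (P.complex.X 1 ⟶ ModuleCat.of R Y) →ₗ[R] (P.complex.X 0 →ₗ[R] QuotSMulTop x Y) :=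
    { toFun := fun f => mkY ∘ₗ f.hom ∘ₗ h
      map_add' := fun f g => by ext; simp
      map_smul' := fun r f => by ext; simp }
  let Θ : (M →ₗ[R] QuotSMulTop x Y) →ₗ[R] (P.complex.X 0 →ₗ[R] QuotSMulTop x Y) :=
    LinearMap.lcomp R _ ε
  have hcoc : ∀ f : P.complex.X 1 ⟶ ModuleCat.of R Y, P.complex.d 2 1 ≫ f = 0 →
      ∀ q, f.hom (h (d₁ q)) = x • f.hom q := fun f hf q => by
    obtain ⟨s, hs⟩ := hker₁ (h (d₁ q) - x • q) (by simp [hh])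
    have h0 : f.hom (d₂ s) = 0 := LinearMap.congr_fun (congrArg ModuleCat.Hom.hom hf) s
    rw [hs, map_sub, map_smul, sub_eq_zero] at h0
    exact h0
  obtain ⟨e₃⟩ := (K.sc' 0 1 2).nonempty_homology_linearEquiv (E := M →ₗ[R] QuotSMulTop x Y) Ψ Θ
    (fun a b hab => by
      ext m
      obtain ⟨p, rfl⟩ := hεs m
      exact LinearMap.congr_fun hab p)
    (fun f hf => by
      change P.complex.X 1 ⟶ ModuleCat.of R Y at f
      replace hf : P.complex.d 2 1 ≫ f = 0 := hf
      constructor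
      · intro h0
        obtain ⟨g, hg⟩ := hdiv (f.hom ∘ₗ h) (fun n => LinearMap.congr_fun h0 n)
        refine ⟨ModuleCat.ofHom g, ?_⟩
        change P.complex.d 1 0 ≫ ModuleCat.ofHom g = f
        ext q
        apply hY
        exact (hg (d₁ q)).trans (hcoc f hf q)
      · rintro ⟨g, hg⟩
        change P.complex.X 0 ⟶ ModuleCat.of R Y at g
        replace hg : P.complex.d 1 0 ≫ g = f := hg
        subst hg
        ext p
        refine (hmk _).2 ⟨g.hom p, ?_⟩
        change _ = g.hom (d₁ (h p))
        rw [hh, map_smul])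
    (fun f hf => by
      change P.complex.X 1 ⟶ ModuleCat.of R Y at f
      replace hf : P.complex.d 2 1 ≫ f = 0 := hf
      have hle : LinearMap.ker ε ≤ LinearMap.ker (Ψ f) := by
        intro p hp
        obtain ⟨q, rfl⟩ := hker₀ p hp
        exact (hmk _).2 ⟨f.hom q, (hcoc f hf q).symm⟩
      refine ⟨(LinearMap.ker ε).liftQ (Ψ f) hle ∘ₗ
        (ε.quotKerEquivOfSurjective hεs).symm.toLinearMap, ?_⟩
      ext p
      change (LinearMap.ker ε).liftQ (Ψ f) hle
        ((ε.quotKerEquivOfSurjective hεs).symm (ε p)) = Ψ f p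
      have : (ε.quotKerEquivOfSurjective hεs).symm (ε p) = Submodule.Quotient.mk p := by
        rw [LinearEquiv.symm_apply_eq]; rfl
      rw [this]; rfl)
    (fun φ => by
      obtain ⟨g, hg⟩ := Module.projective_lifting_property mkY (φ ∘ₗ ε) (Submodule.mkQ_surjective _)
      have hg' : ∀ p, (Submodule.Quotient.mk (g p) : QuotSMulTop x Y) = φ (ε p) :=
        fun p => LinearMap.congr_fun hg p
      obtain ⟨f, hf⟩ := hdiv (g ∘ₗ d₁) (fun q => by simp [hg', hεd])
      refine ⟨(ModuleCat.ofHom f : P.complex.X 1 ⟶ ModuleCat.of R Y), ?_, ?_⟩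
      · change P.complex.d 2 1 ≫ ModuleCat.ofHom f = 0
        ext s
        apply hY
        change x • f (d₂ s) = x • 0
        rw [hf, LinearMap.comp_apply, hdd, map_zero, smul_zero]
      · ext p
        change (Submodule.Quotient.mk (f (h p)) : QuotSMulTop x Y) = φ (ε p)
        rw [← hg']
        congr 1
        apply hY
        change x • f (h p) = x • g p
        rw [hf, LinearMap.comp_apply, hh, map_smul])
  exact ⟨e₁ ≪≫ₗ e₂ ≪≫ₗ e₃⟩

theorem rlength_eq_iff_surjective {R : Type u} [CommRing R] {M N : Type*}
    [AddCommGroup M] [Module R M] [AddCommGroup N] [Module R N]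
    [IsNoetherian R N] [IsArtinian R N] (f : M →ₗ[R] N) (hf : Function.Injective f) :
    rlength R N = rlength R M ↔ Function.Surjective f := by
  rw [rlength, rlength, ← Module.coe_length, ← Module.coe_length, WithBot.coe_inj,
    (LinearEquiv.ofInjective f hf).length_eq, ← LinearMap.range_eq_top]
  constructor
  · intro h
    by_contra hne
    exact (Submodule.length_lt hne).ne h.symm
  · intro h
    rw [h, Module.length_top]

theorem LinearEquiv.rlength_eq {R : Type u} [CommRing R] {M N : Type*}
    [AddCommGroup M] [Module R M] [AddCommGroup N] [Module R N] (e : M ≃ₗ[R] N) :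
    rlength R M = rlength R N := by
  rw [rlength, rlength, ← Module.coe_length, ← Module.coe_length, e.length_eq]

section ResidueFieldHom

variable {R : Type u} [CommRing R] [IsLocalRing R] {M N : Type*}
  [AddCommGroup M] [Module R M] [AddCommGroup N] [Module R N]

theorem IsLocalRing.smul_residueField_eq_zero {a : R} (ha : a ∈ maximalIdeal R)
    (c : ResidueField R) : a • c = 0 := by
  rw [Algebra.smul_def, ResidueField.algebraMap_eq, (residue_eq_zero_iff a).2 ha, zero_mul]

theorem IsLocalRing.residueField_hom_ext {φ ψ : ResidueField R →ₗ[R] N} (h : φ 1 = ψ 1) :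
    φ = ψ := by
  ext c
  obtain ⟨r, rfl⟩ := residue_surjective c
  have : residue R r = r • (1 : ResidueField R) := by
    rw [Algebra.smul_def, mul_one, ResidueField.algebraMap_eq]
  rw [this, map_smul, map_smul, h]

theorem IsLocalRing.smul_residueField_hom_apply {a : R} (ha : a ∈ maximalIdeal R)
    (φ : ResidueField R →ₗ[R] N) (c : ResidueField R) : a • φ c = 0 := by
  rw [← map_smul, smul_residueField_eq_zero ha, map_zero]

theorem IsLocalRing.exists_residueField_hom (n : N) (hn : ∀ a ∈ maximalIdeal R, a • n = 0) :
    ∃ φ : ResidueField R →ₗ[R] N, φ 1 = n := by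
  refine ⟨(maximalIdeal R).liftQ (LinearMap.toSpanSingleton R N n) fun a ha => hn a ha, ?_⟩
  exact one_smul R n

instance [IsNoetherian R N] : IsNoetherian R (ResidueField R →ₗ[R] N) :=
  isNoetherian_of_injective (LinearMap.applyₗ (1 : ResidueField R))
    fun _ _ h => residueField_hom_ext h

instance [IsNoetherian R N] : IsArtinian R (ResidueField R →ₗ[R] N) := by
  have ht : Module.IsTorsionBySet R (ResidueField R →ₗ[R] N) (maximalIdeal R) := by
    intro φ a
    ext c
    exact smul_residueField_hom_apply a.2 φ c
  let := ht.module
  let : Field (R ⧸ maximalIdeal R) := Ideal.Quotient.field _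
  have : IsSemisimpleModule R (ResidueField R →ₗ[R] N) :=
    ht.isSemisimpleModule_iff.1 inferInstance
  infer_instance

theorem IsLocalRing.residueField_hom_postcomp_injective (j : M →ₗ[R] N)
    (hj : Function.Injective j) :
    Function.Injective (LinearMap.compRight R j (M := ResidueField R)) := by
  intro φ ψ h
  exact residueField_hom_ext (hj (LinearMap.congr_fun h 1))

theorem IsLocalRing.residueField_hom_postcomp_surjective_iff (j : M →ₗ[R] N)
    (hj : Function.Injective j) :
    Function.Surjective (LinearMap.compRight R j (M := ResidueField R)) ↔
      ∀ n : N, (∀ a ∈ maximalIdeal R, a • n = 0) → n ∈ LinearMap.range j := by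
  constructor
  · intro h n hn
    obtain ⟨φ, rfl⟩ := exists_residueField_hom n hn
    obtain ⟨ψ, rfl⟩ := h φ
    exact ⟨ψ 1, rfl⟩
  · intro h φ
    obtain ⟨m, hm⟩ := h (φ 1) fun a ha => smul_residueField_hom_apply ha φ 1
    obtain ⟨ψ, hψ⟩ := exists_residueField_hom m fun a ha => hj <| by
      rw [map_smul, hm, smul_residueField_hom_apply ha, map_zero]
    exact ⟨ψ, residueField_hom_ext (by simp [hψ, hm])⟩

end ResidueFieldHom

open scoped Pointwise in
theorem Ideal.exists_quotSMulTop_linearMap {R : Type u} [CommRing R] (I : Ideal R) (x : R) :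
    ∃ i : QuotSMulTop x I →ₗ[R] R ⧸ (Ideal.span {x} * I), Function.Injective i ∧
      ∀ y : I, i (Submodule.Quotient.mk y) = Submodule.Quotient.mk (y : R) := by
  have hi : x • (⊤ : Submodule R I) =
      Submodule.comap (Submodule.subtype I) (Ideal.span {x} * I) := by
    ext ⟨r, hr⟩
    rw [Submodule.mem_smul_pointwise_iff_exists, Submodule.mem_comap, Submodule.subtype_apply,
      Ideal.mem_span_singleton_mul]
    simp [Subtype.ext_iff]
  refine ⟨Submodule.mapQ _ _ (Submodule.subtype I) hi.le, ?_, fun _ => rfl⟩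
  rw [← LinearMap.ker_eq_bot, Submodule.ker_mapQ, ← hi, Submodule.mkQ_map_self]

theorem elias_iff_colon_le_span (R : Type u) [CommRing R] [IsLocalRing R] [IsNoetherianRing R]
    (hdim : ringKrullDim R = 1)
    (hCM : ∃ x ∈ maximalIdeal R, x ∈ nonZeroDivisors R)
    (I : Ideal R) (hI : IsMPrimary R I)
    (x : R) (hxm : x ∈ maximalIdeal R) (hx : x ∈ nonZeroDivisors R) :
    idealType R I = quotType R I ↔
      (Ideal.span {x} * I).colon (maximalIdeal R) ≤ Ideal.span {x} := by

  have hx' : ∀ a b : R, x * a = x * b → a = b := fun a b h =>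
    (mul_cancel_left_mem_nonZeroDivisors hx).1 h
  let J : Ideal R := Ideal.span {x} * I
  have hJ : ∀ r, r ∈ J ↔ ∃ s ∈ I, x * s = r := fun r => Ideal.mem_span_singleton_mul
  obtain ⟨e⟩ := nonempty_ext_one_linearEquiv (ResidueField R) I x
    (smul_residueField_eq_zero hxm) (fun a b h => Subtype.ext (hx' _ _ (congrArg Subtype.val h)))
  obtain ⟨i, hi_inj, hi⟩ := I.exists_quotSMulTop_linearMap x
  let j : (R ⧸ I) →ₗ[R] R ⧸ J := Submodule.mapQ I J (LinearMap.mulLeft R x)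
    fun r hr => (hJ _).2 ⟨r, hr, rfl⟩
  have hj_inj : Function.Injective j := by
    rw [injective_iff_map_eq_zero]
    intro q hq
    obtain ⟨r, rfl⟩ := Submodule.Quotient.mk_surjective _ q
    obtain ⟨s, hs, h⟩ := (hJ _).1 ((Submodule.Quotient.mk_eq_zero J).1 hq)
    rw [Submodule.Quotient.mk_eq_zero, ← hx' _ _ h]
    exact hs
  have hsoc : ∀ r : R, (∀ a ∈ maximalIdeal R, a • (Submodule.Quotient.mk r : R ⧸ J) = 0) ↔
      r ∈ J.colon (maximalIdeal R) := fun r => by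
    rw [Submodule.mem_colon]
    refine forall₂_congr fun a _ => ?_
    rw [← Submodule.Quotient.mk_smul, Submodule.Quotient.mk_eq_zero, smul_eq_mul, smul_eq_mul,
      mul_comm]
  have hi_surj := (residueField_hom_postcomp_surjective_iff i hi_inj).2 fun n hn => by
    obtain ⟨r, rfl⟩ := Submodule.Quotient.mk_surjective _ n
    obtain ⟨s, hs, h⟩ := (hJ _).1 (Submodule.mem_colon.1 ((hsoc r).1 hn) x hxm)
    have hr : r ∈ I := by
      rw [← hx' s r (by rw [h, smul_eq_mul, mul_comm])]
      exact hs
    exact ⟨Submodule.Quotient.mk ⟨r, hr⟩, hi _⟩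
  have hlen : idealType R I = rlength R (ResidueField R →ₗ[R] R ⧸ J) :=
    e.rlength_eq.trans (LinearEquiv.ofBijective _
      ⟨residueField_hom_postcomp_injective i hi_inj, hi_surj⟩).rlength_eq
  rw [hlen, quotType, rlength_eq_iff_surjective _ (residueField_hom_postcomp_injective j hj_inj),
    residueField_hom_postcomp_surjective_iff j hj_inj]
  constructor
  · intro h r hr
    obtain ⟨q, hq⟩ := h (Submodule.Quotient.mk r) ((hsoc r).2 hr)
    obtain ⟨t, rfl⟩ := Submodule.Quotient.mk_surjective _ q
    obtain ⟨s, -, hs⟩ := (hJ _).1 ((Submodule.Quotient.eq J).1 hq)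
    rw [Ideal.mem_span_singleton]
    exact ⟨t - s, by rw [mul_sub, hs]; simp⟩
  · intro h n hn
    obtain ⟨r, rfl⟩ := Submodule.Quotient.mk_surjective _ n
    obtain ⟨t, rfl⟩ := Ideal.mem_span_singleton.1 (h ((hsoc r).1 hn))
    exact ⟨Submodule.Quotient.mk t, rfl⟩
end

section
/- Let (R, m) be a one-dimensional Cohen-Macaulay local ring with total ring of fractions Q, and I an m-primary ideal. Then I is Elias (i.e., type(I) = type(R/I)) if and only if I :_Q m ⊆ R, where I :_Q m = { q ∈ Q : qm ⊆ I }. -/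
open CategoryTheory IsLocalRing

universe u

/-- A linear map into the cycles of a short complex of modules which meets every homology class
presents the homology as a quotient of its source. -/
lemma CategoryTheory.ShortComplex.nonempty_homology_linearEquiv_quotient {R : Type*} [CommRing R]
    (S : ShortComplex (ModuleCat R)) {N : Type*} [AddCommGroup N] [Module R N] (Ψ : N →ₗ[R] S.X₂)
    (hcycle : ∀ n, S.g (Ψ n) = 0)
    (hsurj : ∀ z, S.g z = 0 → ∃ n x, z = Ψ n + S.f x) :
    Nonempty (S.homology ≃ₗ[R] N ⧸ (LinearMap.range S.f.hom).comap Ψ) := by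
  let Φ : N →ₗ[R] LinearMap.ker S.g.hom ⧸ LinearMap.range S.moduleCatToCycles :=
    (Submodule.mkQ _).comp (Ψ.codRestrict _ hcycle)
  have hΦ : Function.Surjective Φ := by
    intro q
    obtain ⟨⟨z, hz⟩, rfl⟩ := Submodule.Quotient.mk_surjective _ q
    obtain ⟨n, x, h⟩ := hsurj z hz
    refine ⟨n, (Submodule.Quotient.eq _).2 ⟨-x, Subtype.ext ?_⟩⟩
    change S.f (-x) = Ψ n - z
    rw [h, map_neg, sub_add_cancel_left]
  have hker : LinearMap.ker Φ = (LinearMap.range S.f.hom).comap Ψ := by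
    ext n
    refine (Submodule.Quotient.mk_eq_zero _).trans ?_
    constructor
    · rintro ⟨x, hx⟩
      exact ⟨x, congrArg Subtype.val hx⟩
    · rintro ⟨x, hx⟩
      exact ⟨x, Subtype.ext hx⟩
  exact ⟨(S.moduleCatHomologyIso.toLinearEquiv).trans
    ((Φ.quotKerEquivOfSurjective hΦ).symm.trans (Submodule.quotEquivOfEq _ _ hker))⟩

/-- Restriction to the maximal ideal, as a map `M ≃ Hom(R, M) → Hom(𝔪, M)`. -/
def IsLocalRing.smulRestrict (R : Type*) [CommRing R] [IsLocalRing R]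
    (M : Type*) [AddCommGroup M] [Module R M] :
    M →ₗ[R] (maximalIdeal R →ₗ[R] M) :=
  ((LinearMap.lsmul R M).domRestrict (maximalIdeal R)).flip

/-- `Ext¹(k, M)` is the cokernel of `M → Hom(𝔪, M)`. -/
lemma IsLocalRing.nonempty_ext_one_residueField_linearEquiv (R : Type u) [CommRing R]
    [IsLocalRing R] (M : ModuleCat.{u} R) :
    Nonempty ((((_root_.Ext R (ModuleCat.{u} R) 1).obj
      (Opposite.op (ModuleCat.of R (ResidueField R)))).obj M) ≃ₗ[R]
        (maximalIdeal R →ₗ[R] M) ⧸ LinearMap.range (smulRestrict R M)) := by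
  let P := CategoryTheory.projectiveResolution (ModuleCat.of R (ResidueField R))
  have e₁ := (P.isoExt (R := R) 1 M).toLinearEquiv
  have e₂ := (ShortComplex.homologyMapIso
    ((P.complex.linearYonedaObj R M).isoSc' 0 1 2 (by simp) (by simp))).toLinearEquiv
  let π : P.complex.X 0 →ₗ[R] ResidueField R := (P.π.f 0).hom
  let d₁ : P.complex.X 1 →ₗ[R] P.complex.X 0 := (P.complex.d 1 0).hom
  let d₂ : P.complex.X 2 →ₗ[R] P.complex.X 1 := (P.complex.d 2 1).hom
  have hπ : Function.Surjective π := (ModuleCat.epi_iff_surjective (P.π.f 0)).1 inferInstance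
  have hex₁ : ∀ x, π x = 0 → ∃ y, d₁ y = x := by
    have := ShortComplex.exact_of_g_is_cokernel
      (ShortComplex.mk _ _ P.complex_d_comp_π_f_zero) P.isColimitCokernelCofork
    exact (ShortComplex.moduleCat_exact_iff _).1 this
  have hex₂ : ∀ x, d₁ x = 0 → ∃ y, d₂ y = x :=
    (ShortComplex.moduleCat_exact_iff _).1 (P.exact_succ 0)
  have hπd : ∀ y, π (d₁ y) = 0 := fun y =>
    LinearMap.congr_fun (congrArg ModuleCat.Hom.hom P.complex_d_comp_π_f_zero) y
  have hdd : ∀ y, d₁ (d₂ y) = 0 := fun y =>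
    LinearMap.congr_fun (congrArg ModuleCat.Hom.hom (P.complex.d_comp_d 2 1 0)) y
  obtain ⟨p, hp⟩ := hπ 1
  have : Module.Projective R (P.complex.X 0) :=
    (IsProjective.iff_projective _).2 (P.projective 0)
  obtain ⟨s, hs⟩ := Module.projective_lifting_property
    (Algebra.linearMap R (ResidueField R)) π residue_surjective
  have hs' : ∀ x, residue R (s x) = π x := fun x => LinearMap.congr_fun hs x
  let ρ : P.complex.X 1 →ₗ[R] maximalIdeal R :=
    (s.comp d₁).codRestrict _ fun y => by
      rw [← residue_eq_zero_iff]
      exact (hs' _).trans (hπd y)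
  have hmul : ∀ x, π (x - s x • p) = 0 := fun x => by
    rw [map_sub, map_smul, hp, ← hs', Algebra.smul_def, mul_one]
    exact sub_self _
  have hu : IsUnit (s p) := by
    rw [← residue_ne_zero_iff_isUnit, hs', hp]
    exact one_ne_zero
  obtain ⟨u, hu⟩ := hu
  have hap : ∀ a ∈ maximalIdeal R, π (a • p) = 0 := fun a ha => by
    rw [map_smul, hp, Algebra.smul_def, mul_one]
    exact (residue_eq_zero_iff _).2 ha
  let S := (P.complex.linearYonedaObj R M).sc' 0 1 2
  let Ψ : (maximalIdeal R →ₗ[R] M) →ₗ[R] S.X₂ :=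
    { toFun := fun f => (ModuleCat.ofHom (f.comp ρ) : P.complex.X 1 ⟶ M)
      map_add' := fun _ _ => rfl
      map_smul' := fun _ _ => rfl }
  obtain ⟨e₃⟩ := S.nonempty_homology_linearEquiv_quotient Ψ
    (fun f => by
      refine ModuleCat.hom_ext (LinearMap.ext fun y => ?_)
      change f (ρ (d₂ y)) = 0
      have : ρ (d₂ y) = 0 := Subtype.ext (by simp [ρ, hdd])
      rw [this, map_zero])
    (fun z hz => by
      let φ : P.complex.X 1 →ₗ[R] M := ModuleCat.Hom.hom (z : P.complex.X 1 ⟶ M)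
      have hφ : ∀ y, φ (d₂ y) = 0 := fun y =>
        LinearMap.congr_fun (congrArg ModuleCat.Hom.hom (hz : (P.complex.d 2 1 ≫ z) = 0)) y
      let d' : P.complex.X 1 →ₗ[R] LinearMap.ker π := d₁.codRestrict _ hπd
      have hd' : Function.Surjective d' := fun x => by
        obtain ⟨y, hy⟩ := hex₁ x x.2
        exact ⟨y, Subtype.ext hy⟩
      let h : LinearMap.ker π →ₗ[R] M :=
        ((LinearMap.ker d').liftQ φ fun y hy => by
          obtain ⟨w, rfl⟩ := hex₂ y (congrArg Subtype.val hy)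
          exact hφ w).comp (d'.quotKerEquivOfSurjective hd').symm.toLinearMap
      have hh : ∀ y, h (d' y) = φ y := fun y => by
        have : (d'.quotKerEquivOfSurjective hd').symm (d' y) = Submodule.Quotient.mk y := by
          rw [LinearEquiv.symm_apply_eq]; rfl
        simp [h, this]
      let f : maximalIdeal R →ₗ[R] M :=
        h.comp ((((LinearMap.toSpanSingleton R _ p).comp (maximalIdeal R).subtype)).codRestrict _
          fun a => hap a a.2)
      let g : P.complex.X 0 →ₗ[R] M :=
        h.comp ((LinearMap.id - (LinearMap.toSpanSingleton R _ p).comp s).codRestrict _ hmul)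
      refine ⟨f, (ModuleCat.ofHom g : P.complex.X 0 ⟶ M), ?_⟩
      refine ModuleCat.hom_ext (LinearMap.ext fun y => ?_)
      change φ y = f (ρ y) + g (d₁ y)
      rw [← hh]
      simp only [f, g, LinearMap.comp_apply, ← map_add]
      congr 1
      refine Subtype.ext ?_
      change d₁ y = s (d₁ y) • p + (d₁ y - s (d₁ y) • p)
      rw [add_sub_cancel])
  have hrange : (LinearMap.range S.f.hom).comap Ψ = LinearMap.range (smulRestrict R M) := by
    ext f
    constructor
    · rintro ⟨g, hg⟩
      let g' : P.complex.X 0 →ₗ[R] M := ModuleCat.Hom.hom (g : P.complex.X 0 ⟶ M)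
      have hg' : ∀ y, g' (d₁ y) = f (ρ y) := fun y =>
        LinearMap.congr_fun (congrArg ModuleCat.Hom.hom
          (hg : (P.complex.d 1 0 ≫ g) = ModuleCat.ofHom (f.comp ρ))) y
      refine ⟨(↑u⁻¹ : R) • g' p, LinearMap.ext fun a => ?_⟩
      obtain ⟨y, hy⟩ := hex₁ _ (hap a a.2)
      have hρ : ρ y = (u : R) • a := Subtype.ext (by simp [ρ, hy, hu, mul_comm])
      have := hg' y
      rw [hy, hρ, map_smul, map_smul] at this
      change (a : R) • (↑u⁻¹ : R) • g' p = f a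
      rw [smul_comm, this, smul_smul, Units.inv_mul, one_smul]
    · rintro ⟨x, rfl⟩
      refine ⟨(ModuleCat.ofHom ((LinearMap.toSpanSingleton R M x).comp s) :
        P.complex.X 0 ⟶ M), ?_⟩
      exact ModuleCat.hom_ext (LinearMap.ext fun y => rfl)
  exact ⟨e₁.trans (e₂.trans (e₃.trans (Submodule.quotEquivOfEq _ _ hrange)))⟩

lemma Submodule.length_eq_length_iff_eq_top {R M : Type*} [Ring R] [AddCommGroup M] [Module R M]
    (N : Submodule R M) (hN : Module.length R N ≠ ⊤) :
    Module.length R M = Module.length R N ↔ N = ⊤ := by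
  have h := Module.length_eq_add_of_exact N.subtype N.mkQ N.subtype_injective
    N.mkQ_surjective (LinearMap.exact_subtype_mkQ N)
  rw [h, ← Submodule.Quotient.subsingleton_iff, ← Module.length_eq_zero_iff (R := R)]
  refine ⟨fun h => ?_, fun h => by rw [h, add_zero]⟩
  exact ENat.add_right_injective_of_ne_top hN (h.trans (add_zero _).symm)

/-- An element `r ∈ (I : 𝔪)` induces the map `k → R ⧸ I` sending `1` to the class of `r`. -/
noncomputable def IsLocalRing.colonToHom {R : Type*} [CommRing R] [IsLocalRing R] (I : Ideal R) :
    I.colon (maximalIdeal R : Set R) →ₗ[R] (ResidueField R →ₗ[R] R ⧸ I) where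
  toFun r := (maximalIdeal R).liftQ (LinearMap.toSpanSingleton R (R ⧸ I) (I.mkQ r)) fun a ha => by
    rw [LinearMap.mem_ker, LinearMap.toSpanSingleton_apply, ← map_smul]
    refine (Submodule.Quotient.mk_eq_zero _).2 ?_
    rw [smul_eq_mul, mul_comm]
    exact Submodule.mem_colon.1 r.2 a ha
  map_add' r s := LinearMap.ext fun x => by
    obtain ⟨a, rfl⟩ := Ideal.Quotient.mk_surjective x
    exact smul_add a (I.mkQ r) (I.mkQ s)
  map_smul' t r := LinearMap.ext fun x => by
    obtain ⟨a, rfl⟩ := Ideal.Quotient.mk_surjective x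
    exact smul_comm a t (I.mkQ r)

lemma IsLocalRing.colonToHom_apply_one {R : Type*} [CommRing R] [IsLocalRing R] (I : Ideal R)
    (r : I.colon (maximalIdeal R : Set R)) : colonToHom I r 1 = I.mkQ r :=
  one_smul R (I.mkQ (r : R))

lemma IsLocalRing.residueField_hom_ext_s3 {R M : Type*} [CommRing R] [IsLocalRing R]
    [AddCommGroup M] [Module R M] {f g : ResidueField R →ₗ[R] M} (h : f 1 = g 1) : f = g := by
  refine LinearMap.ext fun x => ?_
  obtain ⟨a, rfl⟩ := residue_surjective x
  have : residue R a = a • (1 : ResidueField R) := by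
    rw [Algebra.smul_def, mul_one]; rfl
  rw [this, map_smul, map_smul, h]

lemma IsLocalRing.colonToHom_surjective {R : Type*} [CommRing R] [IsLocalRing R] (I : Ideal R) :
    Function.Surjective (colonToHom I) := by
  intro f
  obtain ⟨r, hr⟩ := I.mkQ_surjective (f 1)
  refine ⟨⟨r, Submodule.mem_colon.2 fun a ha => ?_⟩,
    residueField_hom_ext_s3 ((colonToHom_apply_one I _).trans hr)⟩
  rw [smul_eq_mul, mul_comm, ← smul_eq_mul, ← Submodule.Quotient.mk_eq_zero]
  change I.mkQ (a • r) = 0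
  rw [map_smul, hr, ← map_smul, Algebra.smul_def, mul_one,
    show algebraMap R (ResidueField R) a = 0 from (residue_eq_zero_iff a).2 ha, map_zero]

lemma IsLocalRing.mem_ker_colonToHom {R : Type*} [CommRing R] [IsLocalRing R] (I : Ideal R)
    (r : I.colon (maximalIdeal R : Set R)) : r ∈ LinearMap.ker (colonToHom I) ↔ (r : R) ∈ I := by
  rw [LinearMap.mem_ker, ← Submodule.Quotient.mk_eq_zero (p := I)]
  change _ ↔ I.mkQ r = 0
  rw [← colonToHom_apply_one]
  exact ⟨fun h => by rw [h]; rfl, fun h => residueField_hom_ext_s3 h⟩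

/-- An element `r ∈ (I : 𝔪)` acts by multiplication as a map `𝔪 → I`. -/
def IsLocalRing.colonMul {R : Type*} [CommRing R] [IsLocalRing R] (I : Ideal R) :
    I.colon (maximalIdeal R : Set R) →ₗ[R] (maximalIdeal R →ₗ[R] I) where
  toFun r := ((LinearMap.lsmul R R r).domRestrict (maximalIdeal R)).codRestrict I
    fun a => Submodule.mem_colon.1 r.2 a a.2
  map_add' r s := LinearMap.ext fun a => Subtype.ext (add_mul (r : R) s a)
  map_smul' t r := LinearMap.ext fun a => Subtype.ext (mul_assoc t (r : R) a)

lemma IsLocalRing.colonMul_mem_range_smulRestrict {R : Type*} [CommRing R] [IsLocalRing R]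
    (hreg : ∃ x ∈ maximalIdeal R, x ∈ nonZeroDivisors R) (I : Ideal R)
    (r : I.colon (maximalIdeal R : Set R)) :
    colonMul I r ∈ LinearMap.range (smulRestrict R I) ↔ (r : R) ∈ I := by
  constructor
  · rintro ⟨s, hs⟩
    obtain ⟨x, hx, hx'⟩ := hreg
    have : x * (s : R) = r * x := congrArg Subtype.val (LinearMap.congr_fun hs ⟨x, hx⟩)
    rw [mul_comm] at this
    rw [← mul_cancel_right_mem_nonZeroDivisors hx' |>.1 this]
    exact s.2
  · intro hr
    exact ⟨⟨r, hr⟩, LinearMap.ext fun a => Subtype.ext (mul_comm (a : R) r)⟩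

/-- `Hom(𝔪, I)` consists of multiplications by elements of `(I : 𝔪)` iff the colon ideal taken in
the total ring of fractions is contained in `R`. -/
lemma IsLocalRing.colonMul_surjective_iff {R : Type*} [CommRing R] [IsLocalRing R]
    (hreg : ∃ x ∈ maximalIdeal R, x ∈ nonZeroDivisors R) (I : Ideal R) :
    Function.Surjective (colonMul I) ↔
      ∀ q : FractionRing R,
        (∀ a ∈ maximalIdeal R, q * algebraMap R (FractionRing R) a ∈
          Submodule.map (Algebra.linearMap R (FractionRing R)) I) →
        q ∈ Set.range (algebraMap R (FractionRing R)) := by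
  obtain ⟨x, hx, hx'⟩ := hreg
  have hinj := IsFractionRing.injective R (FractionRing R)
  have hunit : IsUnit (algebraMap R (FractionRing R) x) :=
    IsLocalization.map_units (FractionRing R) ⟨x, hx'⟩
  constructor
  · intro hsurj q hq
    have hq' : ∀ a : maximalIdeal R, ∃ b : I,
        algebraMap R (FractionRing R) b = q * algebraMap R (FractionRing R) a := fun a => by
      obtain ⟨b, hb, h⟩ := hq a a.2
      exact ⟨⟨b, hb⟩, h⟩
    choose f hf using hq'
    obtain ⟨r, hr⟩ := hsurj
      { toFun := f
        map_add' := fun a b => Subtype.ext <| hinj <| by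
          rw [Submodule.coe_add, map_add, hf, hf, hf, Submodule.coe_add, map_add, mul_add]
        map_smul' := fun t a => Subtype.ext <| hinj <| by
          rw [RingHom.id_apply, Submodule.coe_smul, smul_eq_mul, map_mul, hf, hf,
            Submodule.coe_smul, smul_eq_mul, map_mul, mul_left_comm] }
    have h : (r : R) * x = f ⟨x, hx⟩ := congrArg Subtype.val (LinearMap.congr_fun hr ⟨x, hx⟩)
    refine ⟨r, hunit.mul_right_cancel ?_⟩
    rw [← map_mul, h]
    exact hf ⟨x, hx⟩
  · intro hcolon f
    have hf : ∀ a : maximalIdeal R, (f ⟨x, hx⟩ : R) * a = x * f a := fun a => by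
      have h₁ : f ((a : R) • ⟨x, hx⟩) = f (x • a) :=
        congrArg f (Subtype.ext (mul_comm (a : R) x))
      rw [map_smul, map_smul] at h₁
      rw [mul_comm]
      exact congrArg Subtype.val h₁
    obtain ⟨v, hv⟩ := hunit
    obtain ⟨r, hr⟩ := hcolon (algebraMap R _ (f ⟨x, hx⟩ : R) * ↑v⁻¹) fun a ha => by
      refine ⟨f ⟨a, ha⟩, (f ⟨a, ha⟩).2, ?_⟩
      rw [Algebra.linearMap_apply, mul_right_comm, ← map_mul, hf ⟨a, ha⟩, map_mul, ← hv,
        mul_right_comm, Units.mul_inv, one_mul]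
    have hrx : r * x = f ⟨x, hx⟩ := hinj <| by
      rw [map_mul, hr, ← hv, mul_assoc, Units.inv_mul, mul_one]
    have hra : ∀ a : maximalIdeal R, r * a = f a := fun a => by
      refine mul_cancel_left_mem_nonZeroDivisors hx' |>.1 ?_
      rw [← hf, ← hrx]
      ring
    refine ⟨⟨r, Submodule.mem_colon.2 fun a ha => ?_⟩,
      LinearMap.ext fun a => Subtype.ext (hra a)⟩
    rw [smul_eq_mul, hra ⟨a, ha⟩]
    exact (f ⟨a, ha⟩).2

lemma IsLocalRing.length_hom_residueField_quotient_ne_top {R : Type*} [CommRing R] [IsLocalRing R]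
    [IsNoetherianRing R] {I : Ideal R} (hI : I.radical = maximalIdeal R) :
    Module.length R (ResidueField R →ₗ[R] R ⧸ I) ≠ ⊤ := by
  have : IsArtinianRing (R ⧸ I) := by
    refine quotient_artinian_of_mem_minimalPrimes_of_isLocalRing I ?_
    rw [← Ideal.radical_minimalPrimes, hI, Ideal.minimalPrimes_eq_subsingleton_self]
    rfl
  have : IsArtinian R (R ⧸ I) :=
    isArtinian_of_surjective_algebraMap (Ideal.Quotient.mk_surjective (I := I))
  exact ne_top_of_le_ne_top Module.length_ne_top
    (Module.length_le_of_injective (LinearMap.applyₗ (R := R) (M₂ := R ⧸ I) (1 : ResidueField R))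
      fun _ _ h => residueField_hom_ext_s3 h)

theorem elias_iff_colonQ_le (R : Type u) [CommRing R] [IsLocalRing R] [IsNoetherianRing R]
    (hdim : ringKrullDim R = 1)
    (hCM : ∃ x ∈ maximalIdeal R, x ∈ nonZeroDivisors R)
    (I : Ideal R) (hI : IsMPrimary R I) :
    EliasIdeal R I ↔
      ∀ q : FractionRing R,
        (∀ a ∈ maximalIdeal R, q * algebraMap R (FractionRing R) a ∈
          Submodule.map (Algebra.linearMap R (FractionRing R)) I) →
        q ∈ Set.range (algebraMap R (FractionRing R)) := by
  obtain ⟨e⟩ := nonempty_ext_one_residueField_linearEquiv R (ModuleCat.of R I)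
  let c := (LinearMap.range (smulRestrict R I)).mkQ.comp (colonMul I)
  have hker : LinearMap.ker (colonToHom I) = LinearMap.ker c := by
    ext r
    rw [mem_ker_colonToHom, ← colonMul_mem_range_smulRestrict hCM]
    exact (Submodule.Quotient.mk_eq_zero _).symm
  have hc : Module.length R (ResidueField R →ₗ[R] R ⧸ I) =
      Module.length R (LinearMap.range c) :=
    (((colonToHom I).quotKerEquivOfSurjective (colonToHom_surjective I)).symm.trans
      ((Submodule.quotEquivOfEq _ _ hker).trans c.quotKerEquivRange)).length_eq
  have hfin := length_hom_residueField_quotient_ne_top hI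
  rw [hc] at hfin
  rw [← colonMul_surjective_iff hCM, EliasIdeal, idealType, quotType, modType, rlength, rlength,
    ← Module.coe_length, ← Module.coe_length, WithBot.coe_inj, e.length_eq, hc]
  refine (Submodule.length_eq_length_iff_eq_top _ hfin).trans ?_
  rw [LinearMap.range_eq_top]
  constructor
  · intro hsurj f
    obtain ⟨r, hr⟩ := hsurj (Submodule.Quotient.mk f)
    obtain ⟨s, hs⟩ := (Submodule.Quotient.eq _).1 hr.symm
    refine ⟨r + ⟨s, Submodule.mem_colon.2 fun a _ => I.mul_mem_right a s.2⟩, ?_⟩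
    rw [map_add, add_comm, ← eq_sub_iff_add_eq, ← hs]
    exact LinearMap.ext fun a => Subtype.ext (mul_comm (s : R) a)
  · exact fun hsurj => (Submodule.mkQ_surjective _).comp hsurj
end

section
/- Let (R, m) be a one-dimensional Cohen-Macaulay local ring. If I is an Elias m-primary ideal and J is an m-primary ideal with J ⊆ I, then J is Elias. (Elias ideals are closed under inclusion.) -/
open CategoryTheory IsLocalRing

universe u

namespace CategoryTheory.ProjectiveResolution

/-- `Ext¹` as cocycles modulo coboundaries of a projective resolution. -/
lemma exists_surjective_cocycles_ext_one {R : Type u} [CommRing R] {X : ModuleCat.{u} R}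
    (P : ProjectiveResolution X) (M : ModuleCat.{u} R) :
    ∃ q : LinearMap.ker (LinearMap.lcomp R M (P.complex.d 2 1).hom) →ₗ[R]
        ((_root_.Ext R (ModuleCat.{u} R) 1).obj (Opposite.op X)).obj M,
      Function.Surjective q ∧
        ∀ z, q z = 0 ↔ ∃ h : P.complex.X 0 →ₗ[R] M, h ∘ₗ (P.complex.d 1 0).hom = z.1 := by
  let K := P.complex.linearYonedaObj R M
  let S := K.sc' 0 1 2
  let e : ((_root_.Ext R (ModuleCat.{u} R) 1).obj (Opposite.op X)).obj M ≅
      ModuleCat.of R (LinearMap.ker S.g.hom ⧸ LinearMap.range S.moduleCatToCycles) :=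
    P.isoExt 1 M ≪≫ ShortComplex.homologyMapIso (K.isoSc' 0 1 2 (by simp) (by simp)) ≪≫
      S.moduleCatHomologyIso
  let c : LinearMap.ker (LinearMap.lcomp R M (P.complex.d 2 1).hom) →ₗ[R]
      LinearMap.ker S.g.hom :=
    LinearMap.codRestrict _
      ((ModuleCat.homLinearEquiv (S := R)).symm.toLinearMap ∘ₗ Submodule.subtype _)
      (fun z ↦ ModuleCat.hom_ext z.2)
  have hc : Function.Surjective c := fun y ↦
    ⟨⟨ModuleCat.Hom.hom y.1, congrArg ModuleCat.Hom.hom y.2⟩, rfl⟩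
  refine ⟨e.toLinearEquiv.symm.toLinearMap ∘ₗ (Submodule.mkQ _) ∘ₗ c, ?_, fun z ↦ ?_⟩
  · exact e.toLinearEquiv.symm.surjective.comp ((Submodule.mkQ_surjective _).comp hc)
  · rw [LinearMap.comp_apply, LinearEquiv.coe_coe, LinearEquiv.map_eq_zero_iff,
      LinearMap.comp_apply, Submodule.mkQ_apply, Submodule.Quotient.mk_eq_zero,
      LinearMap.mem_range]
    constructor
    · rintro ⟨h, hh⟩
      exact ⟨ModuleCat.Hom.hom h, congrArg (fun y ↦ ModuleCat.Hom.hom y.1) hh⟩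
    · rintro ⟨h, hh⟩
      exact ⟨ModuleCat.ofHom h, Subtype.ext (ModuleCat.hom_ext hh)⟩

end CategoryTheory.ProjectiveResolution

/-- Linear maps out of a common module with equal kernels have images of equal length. -/
lemma LinearMap.length_range_eq_of_ker_eq {R W A E : Type*} [Ring R] [AddCommGroup W]
    [AddCommGroup A] [AddCommGroup E] [Module R W] [Module R A] [Module R E]
    (a : W →ₗ[R] A) (b : W →ₗ[R] E) (h : LinearMap.ker a = LinearMap.ker b) :
    Module.length R (LinearMap.range a) = Module.length R (LinearMap.range b) :=
  LinearEquiv.length_eq (a.quotKerEquivRange.symm ≪≫ₗ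
    Submodule.quotEquivOfEq _ _ h ≪≫ₗ b.quotKerEquivRange)

/-- A submodule whose length is finite and equals that of the ambient module is everything. -/
lemma Submodule.length_eq_iff_eq_top {R E : Type*} [Ring R] [AddCommGroup E] [Module R E]
    (N : Submodule R E) (hN : Module.length R N ≠ ⊤) :
    Module.length R E = Module.length R N ↔ N = ⊤ := by
  constructor
  · intro h
    rw [← h, Module.length_ne_top_iff, isFiniteLength_iff_isNoetherian_isArtinian] at hN
    obtain ⟨_, _⟩ := hN
    by_contra hne
    exact (Submodule.length_lt hne).ne h.symm
  · rintro rfl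
    exact Module.length_top.symm

/-- The connecting map `Hom(X, R/I) → Ext¹(X, I)` preserves length exactly when every cocycle
with values in `I` becomes a coboundary in `R`. -/
lemma length_eq_length_hom_quotient_iff {R : Type u} [CommRing R] {X P₀ P₁ P₂ E : Type u}
    [AddCommGroup X] [AddCommGroup P₀] [AddCommGroup P₁] [AddCommGroup P₂] [AddCommGroup E]
    [Module R X] [Module R P₀] [Module R P₁] [Module R P₂] [Module R E] [Module.Projective R P₀]
    {d₂ : P₂ →ₗ[R] P₁} {d₁ : P₁ →ₗ[R] P₀} {π : P₀ →ₗ[R] X}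
    (hd : d₁ ∘ₗ d₂ = 0) (hex : Function.Exact d₁ π) (hπ : Function.Surjective π)
    (hX : ∀ φ : X →ₗ[R] R, φ = 0) (I : Ideal R)
    (q : LinearMap.ker (LinearMap.lcomp R I d₂) →ₗ[R] E) (hq : Function.Surjective q)
    (hq₀ : ∀ z, q z = 0 ↔ ∃ h : P₀ →ₗ[R] I, h ∘ₗ d₁ = z.1)
    (hfin : Module.length R (X →ₗ[R] R ⧸ I) ≠ ⊤) :
    Module.length R E = Module.length R (X →ₗ[R] R ⧸ I) ↔
      ∀ f : P₁ →ₗ[R] I, f ∘ₗ d₂ = 0 → ∃ g : P₀ →ₗ[R] R, I.subtype ∘ₗ f = g ∘ₗ d₁ := by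
  let W : Submodule R (P₀ →ₗ[R] R) :=
    { carrier := {g | ∀ x, g (d₁ x) ∈ I}
      add_mem' := fun ha hb x ↦ I.add_mem (ha x) (hb x)
      zero_mem' := fun _ ↦ I.zero_mem
      smul_mem' := fun r _ ha x ↦ I.mul_mem_left r (ha x) }
  let a : W →ₗ[R] P₀ →ₗ[R] R ⧸ I := (LinearMap.compRight R (Submodule.mkQ I)) ∘ₗ W.subtype
  let j : (X →ₗ[R] R ⧸ I) →ₗ[R] P₀ →ₗ[R] R ⧸ I := LinearMap.lcomp R (R ⧸ I) π
  let β : W →ₗ[R] LinearMap.ker (LinearMap.lcomp R I d₂) :=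
    { toFun := fun g ↦ ⟨(g.1 ∘ₗ d₁).codRestrict I g.2, by
        ext x
        have : d₁ (d₂ x) = 0 := LinearMap.congr_fun hd x
        simp [this]⟩
      map_add' := fun _ _ ↦ rfl
      map_smul' := fun _ _ ↦ rfl }
  have hj : Function.Injective j := fun φ ψ h ↦ by
    ext x
    obtain ⟨y, rfl⟩ := hπ x
    exact LinearMap.congr_fun h y
  have hrange : LinearMap.range j = LinearMap.range a := by
    ext φ
    constructor
    · rintro ⟨ψ, rfl⟩
      obtain ⟨g, hg⟩ := Module.projective_lifting_property (Submodule.mkQ I) (ψ ∘ₗ π)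
        (Submodule.mkQ_surjective I)
      refine ⟨⟨g, fun x ↦ ?_⟩, hg⟩
      have := LinearMap.congr_fun hg (d₁ x)
      rw [LinearMap.comp_apply, LinearMap.comp_apply, hex.apply_apply_eq_zero, map_zero] at this
      exact (Submodule.Quotient.mk_eq_zero I).1 this
    · rintro ⟨g, rfl⟩
      have hle : LinearMap.ker π ≤ LinearMap.ker (a g) := fun y hy ↦ by
        obtain ⟨x, rfl⟩ := (hex y).1 hy
        exact (Submodule.Quotient.mk_eq_zero I).2 (g.2 x)
      refine ⟨(LinearMap.ker π).liftQ (a g) hle ∘ₗ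
        (π.quotKerEquivOfSurjective hπ).symm.toLinearMap, ?_⟩
      ext y
      have : (π.quotKerEquivOfSurjective hπ).symm (π y) = Submodule.Quotient.mk y := by
        rw [LinearEquiv.symm_apply_eq]; rfl
      change (LinearMap.ker π).liftQ (a g) hle
        ((π.quotKerEquivOfSurjective hπ).symm (π y)) = a g y
      rw [this]
      rfl
  have hker : LinearMap.ker a = LinearMap.ker (q ∘ₗ β) := by
    ext g
    change a g = 0 ↔ q (β g) = 0
    rw [hq₀]
    constructor
    · intro hg
      exact ⟨g.1.codRestrict I fun y ↦
        (Submodule.Quotient.mk_eq_zero I).1 (LinearMap.congr_fun hg y), rfl⟩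
    · rintro ⟨h, hh⟩
      have hle : LinearMap.ker π ≤ LinearMap.ker (g.1 - I.subtype ∘ₗ h) := fun y hy ↦ by
        obtain ⟨x, rfl⟩ := (hex y).1 hy
        have := congrArg Subtype.val (LinearMap.congr_fun hh x)
        exact sub_eq_zero.2 this.symm
      have hz := hX ((LinearMap.ker π).liftQ _ hle ∘ₗ
        (π.quotKerEquivOfSurjective hπ).symm.toLinearMap)
      ext y
      have hy := LinearMap.congr_fun hz (π.quotKerEquivOfSurjective hπ (Submodule.Quotient.mk y))
      rw [LinearMap.comp_apply, LinearEquiv.coe_coe, LinearEquiv.symm_apply_apply] at hy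
      have hy' : g.1 y = h y := sub_eq_zero.1 hy
      change Submodule.Quotient.mk (g.1 y) = 0
      rw [hy', Submodule.Quotient.mk_eq_zero]
      exact (h y).2
  have hlen : Module.length R (X →ₗ[R] R ⧸ I) = Module.length R (LinearMap.range (q ∘ₗ β)) := by
    have h := LinearMap.length_range_eq_of_ker_eq (R := R) (W := W)
      (A := P₀ →ₗ[R] R ⧸ I) (E := E) a (q ∘ₗ β) hker
    rw [← h, ← hrange]
    exact (LinearEquiv.ofInjective j hj).length_eq
  rw [hlen] at hfin ⊢
  rw [Submodule.length_eq_iff_eq_top _ hfin, LinearMap.range_eq_top]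
  constructor
  · intro hs f hf
    let z : LinearMap.ker (LinearMap.lcomp R I d₂) := ⟨f, hf⟩
    obtain ⟨g, hg⟩ := hs (q z)
    obtain ⟨h, hh⟩ := (hq₀ (z - β g)).1 ((map_sub q z (β g)).trans (sub_eq_zero.2 hg.symm))
    refine ⟨g.1 + I.subtype ∘ₗ h, ?_⟩
    ext x
    have := congrArg Subtype.val (LinearMap.congr_fun hh x)
    change (h (d₁ x) : R) = f x - g.1 (d₁ x) at this
    change (f x : R) = g.1 (d₁ x) + h (d₁ x)
    rw [this]
    ring
  · intro hs y
    obtain ⟨⟨f, hf⟩, rfl⟩ := hq y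
    obtain ⟨g, hg⟩ := hs f hf
    refine ⟨⟨g, fun x ↦ ?_⟩, ?_⟩
    · rw [← LinearMap.comp_apply, ← hg]
      exact (f x).2
    · rw [LinearMap.comp_apply]
      congr 1
      ext x
      exact (LinearMap.congr_fun hg x).symm

lemma IsMPrimary.length_hom_quotient_ne_top {R : Type u} [CommRing R] [IsLocalRing R]
    [IsNoetherianRing R] {I : Ideal R} (hI : IsMPrimary R I) :
    Module.length R (ResidueField R →ₗ[R] R ⧸ I) ≠ ⊤ := by
  have hmem : maximalIdeal R ∈ I.minimalPrimes := by
    rw [← Ideal.radical_minimalPrimes, show I.radical = maximalIdeal R from hI,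
      Ideal.minimalPrimes_eq_subsingleton_self]
    rfl
  have : IsArtinianRing (R ⧸ I) := quotient_artinian_of_mem_minimalPrimes_of_isLocalRing I hmem
  have : IsArtinian R (R ⧸ I) :=
    isArtinian_of_surjective_algebraMap (Ideal.Quotient.mk_surjective (I := I))
  have hfin : IsFiniteLength R (R ⧸ I) :=
    isFiniteLength_iff_isNoetherian_isArtinian.2 ⟨inferInstance, inferInstance⟩
  rw [Module.length_ne_top_iff]
  refine hfin.of_injective (f := LinearMap.applyₗ (1 : ResidueField R)) fun φ ψ h ↦ ?_
  ext x
  obtain ⟨r, rfl⟩ := IsLocalRing.residue_surjective x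
  have hr : residue R r = r • (1 : ResidueField R) := by
    rw [Algebra.smul_def, mul_one]; rfl
  rw [hr, map_smul, map_smul]
  exact congrArg (r • ·) h

lemma ResidueField.linearMap_eq_zero {R : Type u} [CommRing R] [IsLocalRing R]
    (hreg : ∃ x ∈ maximalIdeal R, x ∈ nonZeroDivisors R) (φ : ResidueField R →ₗ[R] R) :
    φ = 0 := by
  obtain ⟨x, hx, hx'⟩ := hreg
  ext y
  refine (mem_nonZeroDivisors_iff.1 hx').1 _ ?_
  have : x • y = 0 := by
    rw [Algebra.smul_def, show algebraMap R (ResidueField R) x = 0 from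
      (residue_eq_zero_iff x).2 hx, zero_mul]
  rw [← smul_eq_mul, ← map_smul, this, map_zero]

/-- An `m`-primary ideal `I` is Elias iff `Ext¹(k, I) → Ext¹(k, R)` vanishes, expressed through
a projective resolution of `k`. -/
lemma EliasIdeal.iff_cocycle_eq_coboundary {R : Type u} [CommRing R] [IsLocalRing R]
    [IsNoetherianRing R] (hreg : ∃ x ∈ maximalIdeal R, x ∈ nonZeroDivisors R)
    (P : ProjectiveResolution (ModuleCat.of R (ResidueField R)))
    {I : Ideal R} (hI : IsMPrimary R I) :
    EliasIdeal R I ↔ ∀ f : P.complex.X 1 →ₗ[R] I, f ∘ₗ (P.complex.d 2 1).hom = 0 →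
      ∃ g : P.complex.X 0 →ₗ[R] R, I.subtype ∘ₗ f = g ∘ₗ (P.complex.d 1 0).hom := by
  obtain ⟨q, hq, hq₀⟩ := P.exists_surjective_cocycles_ext_one (ModuleCat.of R I)
  have : Module.Projective R (P.complex.X 0) :=
    (IsProjective.iff_projective (P.complex.X 0)).2 (P.projective 0)
  have hd : (P.complex.d 1 0).hom ∘ₗ (P.complex.d 2 1).hom = 0 :=
    congrArg ModuleCat.Hom.hom (P.complex.d_comp_d 2 1 0)
  let π : P.complex.X 0 →ₗ[R] ResidueField R := (P.π.f 0).hom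
  have hex : Function.Exact (P.complex.d 1 0).hom π :=
    (ShortComplex.ShortExact.moduleCat_exact_iff_function_exact _).1 P.exact₀
  have hπ : Function.Surjective π :=
    (ModuleCat.epi_iff_surjective (P.π.f 0)).1 inferInstance
  rw [← length_eq_length_hom_quotient_iff hd hex hπ (ResidueField.linearMap_eq_zero hreg) I q hq
    hq₀ hI.length_hom_quotient_ne_top, ← WithBot.coe_inj, Module.coe_length, Module.coe_length]
  rfl

theorem elias_of_le (R : Type u) [CommRing R] [IsLocalRing R] [IsNoetherianRing R]
    (hdim : ringKrullDim R = 1)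
    (hCM : ∃ x ∈ maximalIdeal R, x ∈ nonZeroDivisors R)
    (I J : Ideal R) (hI : IsMPrimary R I) (hJ : IsMPrimary R J)
    (hE : EliasIdeal R I) (hJI : J ≤ I) :
    EliasIdeal R J := by
  let P := projectiveResolution (ModuleCat.of R (ResidueField R))
  rw [EliasIdeal.iff_cocycle_eq_coboundary hCM P hJ]
  intro f hf
  exact (EliasIdeal.iff_cocycle_eq_coboundary hCM P hI).1 hE (Submodule.inclusion hJI ∘ₗ f)
    (by rw [LinearMap.comp_assoc, hf, LinearMap.comp_zero])
end

section
/- Let (R, m) → (S, n) be a flat local ring homomorphism with S Noetherian local of dimension one, and R a one-dimensional Cohen-Macaulay local ring. Then an m-primary ideal I of R is Elias if and only if IS is an Elias ideal of S. -/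
open CategoryTheory IsLocalRing

universe u

open scoped TensorProduct Pointwise

section Socle

variable {R : Type*} [CommRing R]

/-- Evaluation at `1` identifies `Hom(R/J, M)` with the `J`-torsion of `M`. -/
noncomputable def quotientHomEquivTorsion (J : Ideal R) (M : Type*) [AddCommGroup M] [Module R M] :
    ((R ⧸ J) →ₗ[R] M) ≃ₗ[R] Submodule.torsionBySet R M (J : Set R) where
  toFun f := ⟨f (Submodule.Quotient.mk 1), by
    rw [Submodule.mem_torsionBySet_iff]
    rintro ⟨a, ha⟩
    rw [← map_smul, ← Submodule.Quotient.mk_smul, smul_eq_mul, mul_one,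
      (Submodule.Quotient.mk_eq_zero J).2 ha, map_zero]⟩
  map_add' _ _ := rfl
  map_smul' _ _ := rfl
  invFun x := Submodule.liftQ J (LinearMap.toSpanSingleton R M x) fun a ha ↦
    (Submodule.mem_torsionBySet_iff _ _).1 x.2 ⟨a, ha⟩
  left_inv f := by
    ext
    simp
  right_inv x := Subtype.ext <|
    (Submodule.liftQ_apply J _ 1).trans (LinearMap.toSpanSingleton_apply_one R M _)

/-- A linear equivalence restricts to torsion submodules. -/
noncomputable def torsionBySetCongr (J : Set R) {M N : Type*} [AddCommGroup M] [Module R M]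
    [AddCommGroup N] [Module R N] (e : M ≃ₗ[R] N) :
    Submodule.torsionBySet R M J ≃ₗ[R] Submodule.torsionBySet R N J :=
  e.ofSubmodules _ _ <| by
    ext x
    simp only [Submodule.mem_map_equiv, Submodule.mem_torsionBySet_iff, ← map_smul,
      LinearEquiv.map_eq_zero_iff]

/-- Torsion submodules commute with finite powers. -/
noncomputable def torsionBySetPi (J : Set R) (ι : Type*) (M : Type*) [AddCommGroup M] [Module R M] :
    Submodule.torsionBySet R (ι → M) J ≃ₗ[R] (ι → Submodule.torsionBySet R M J) where
  toFun x i := ⟨x.1 i, (Submodule.mem_torsionBySet_iff _ _).2 fun a ↦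
    congrFun ((Submodule.mem_torsionBySet_iff _ _).1 x.2 a) i⟩
  map_add' _ _ := rfl
  map_smul' _ _ := rfl
  invFun y := ⟨fun i ↦ y i, (Submodule.mem_torsionBySet_iff _ _).2 fun a ↦ funext fun i ↦
    (Submodule.mem_torsionBySet_iff _ _).1 (y i).2 a⟩
  left_inv _ := rfl
  right_inv _ := rfl

/-- Over a Noetherian local ring the socle of a finite module is a finite power of the residue
field. -/
theorem exists_socle_equiv [IsLocalRing R] [IsNoetherianRing R] (M : Type*) [AddCommGroup M]
    [Module R M] [Module.Finite R M] :
    ∃ n : ℕ, Nonempty (Submodule.torsionBySet R M (maximalIdeal R : Set R) ≃ₗ[R]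
      (Fin n → R ⧸ maximalIdeal R)) := by
  let _ : Field (R ⧸ maximalIdeal R) := Ideal.Quotient.field _
  let T := Submodule.torsionBySet R M (maximalIdeal R : Set R)
  have : IsScalarTower R (R ⧸ maximalIdeal R) T :=
    (Submodule.torsionBySet_isTorsionBySet (R := R) (M := M) (maximalIdeal R : Set R)).isScalarTower
  have : Module.Finite R T := inferInstance
  have : Module.Finite (R ⧸ maximalIdeal R) T := Module.Finite.of_restrictScalars_finite R _ _
  exact ⟨_, ⟨(Module.finBasis (R ⧸ maximalIdeal R) T).equivFun.restrictScalars R⟩⟩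

theorem length_socle_ne_top [IsLocalRing R] [IsNoetherianRing R] (M : Type*) [AddCommGroup M]
    [Module R M] [Module.Finite R M] :
    Module.length R (Submodule.torsionBySet R M (maximalIdeal R : Set R)) ≠ ⊤ := by
  obtain ⟨n, ⟨e⟩⟩ := exists_socle_equiv (R := R) M
  have : IsSimpleModule R (R ⧸ maximalIdeal R) := isSimpleModule_iff_isCoatom.2
    (maximalIdeal.isMaximal R).out
  rw [e.length_eq, Module.length_pi, Module.length_eq_one]
  simp

/-- Iterated torsion for `J ⊆ K` is `K`-torsion. -/
noncomputable def torsionBySetTorsionBySet {J K : Set R} (h : J ⊆ K) (M : Type*) [AddCommGroup M]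
    [Module R M] :
    Submodule.torsionBySet R (Submodule.torsionBySet R M J) K ≃ₗ[R]
      Submodule.torsionBySet R M K where
  toFun x := ⟨x.1.1, (Submodule.mem_torsionBySet_iff _ _).2 fun a ↦
    congrArg Subtype.val ((Submodule.mem_torsionBySet_iff _ _).1 x.2 a)⟩
  map_add' _ _ := rfl
  map_smul' _ _ := rfl
  invFun x := ⟨⟨x.1, Submodule.torsionBySet_le_torsionBySet_of_subset h x.2⟩,
    (Submodule.mem_torsionBySet_iff _ _).2 fun a ↦ Subtype.ext <|
      (Submodule.mem_torsionBySet_iff _ _).1 x.2 a⟩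
  left_inv _ := rfl
  right_inv _ := rfl

/-- Over a flat extension `S` of `R`, the elements of `S ⊗ M` killed by a finitely generated
ideal of `R` come from `S ⊗ M[J]`. -/
theorem range_baseChange_torsion (S : Type*) [CommRing S] [Algebra R S] [Module.Flat R S]
    {J : Ideal R} (hJ : J.FG) (M : Type*) [AddCommGroup M] [Module R M] :
    LinearMap.range ((Submodule.torsionBySet R M (J : Set R)).subtype.baseChange S) =
      Submodule.torsionBySet S (S ⊗[R] M) (J.map (algebraMap R S) : Set S) := by
  classical
  obtain ⟨s, rfl⟩ := hJ
  let f : M →ₗ[R] (s → M) := LinearMap.pi fun a ↦ LinearMap.lsmul R M a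
  have hex : Function.Exact
      (Submodule.torsionBySet R M (Ideal.span (s : Set R) : Set R)).subtype f := by
    rw [LinearMap.exact_iff, Submodule.range_subtype,
      ← Submodule.torsionBySet_eq_torsionBySet_span]
    ext x
    simp [f, funext_iff]
  have hex' := Module.Flat.lTensor_exact S hex
  have hf : ∀ (z : S ⊗[R] M) (a : s),
      TensorProduct.piRight R S S (fun _ : s ↦ M) (f.lTensor S z) a =
        algebraMap R S a • z := by
    intro z a
    induction z with
    | zero => simp
    | add x y hx hy => simp only [map_add, Pi.add_apply, hx, hy, smul_add]
    | tmul x y => simp [f, algebraMap_smul, TensorProduct.smul_tmul']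
  ext z
  rw [Ideal.map_span, ← Submodule.torsionBySet_eq_torsionBySet_span (s := algebraMap R S '' s),
    Submodule.mem_torsionBySet_iff]
  refine Iff.trans (Iff.symm (hex' z)) ?_
  rw [← (TensorProduct.piRight R S S (fun _ : s ↦ M)).map_eq_zero_iff, funext_iff]
  simp [hf]

/-- The torsion submodule commutes with flat base change. -/
noncomputable def torsionBaseChangeEquiv (S : Type*) [CommRing S] [Algebra R S] [Module.Flat R S]
    {J : Ideal R} (hJ : J.FG) (M : Type*) [AddCommGroup M] [Module R M] :
    S ⊗[R] Submodule.torsionBySet R M (J : Set R) ≃ₗ[S]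
      Submodule.torsionBySet S (S ⊗[R] M) (J.map (algebraMap R S) : Set S) :=
  LinearEquiv.ofInjective ((Submodule.torsionBySet R M (J : Set R)).subtype.baseChange S)
      (Module.Flat.lTensor_preserves_injective_linearMap _ (Submodule.subtype_injective _)) ≪≫ₗ
    LinearEquiv.ofEq _ _ (range_baseChange_torsion S hJ M)

/-- The change of rings formula for the dimension of socles along a flat local extension. -/
theorem length_socle_baseChange [IsLocalRing R] [IsNoetherianRing R] {S : Type*} [CommRing S]
    [IsLocalRing S] [Algebra R S] [Module.Flat R S] [IsLocalHom (algebraMap R S)]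
    {M : Type*} [AddCommGroup M] [Module R M] [Module.Finite R M]
    {N : Type*} [AddCommGroup N] [Module S N] (f : S ⊗[R] M ≃ₗ[S] N) :
    Module.length S (Submodule.torsionBySet S N (maximalIdeal S : Set S)) =
      Module.length R (Submodule.torsionBySet R M (maximalIdeal R : Set R)) *
        Module.length S (Submodule.torsionBySet S (S ⧸ (maximalIdeal R).map (algebraMap R S))
          (maximalIdeal S : Set S)) := by
  obtain ⟨n, ⟨e⟩⟩ := exists_socle_equiv (R := R) M
  have : IsSimpleModule R (R ⧸ maximalIdeal R) := isSimpleModule_iff_isCoatom.2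
    (maximalIdeal.isMaximal R).out
  let e' : Submodule.torsionBySet S N ((maximalIdeal R).map (algebraMap R S) : Set S)
      ≃ₗ[S] (Fin n → S ⧸ (maximalIdeal R).map (algebraMap R S)) :=
    (torsionBySetCongr _ f).symm ≪≫ₗ
      (torsionBaseChangeEquiv S (maximalIdeal R).fg_of_isNoetherianRing M).symm ≪≫ₗ
      e.baseChange R S _ _ ≪≫ₗ TensorProduct.piRight R S S _ ≪≫ₗ
      LinearEquiv.piCongrRight fun _ ↦ (Ideal.qoutMapEquivTensorQout S).symm
  rw [e.length_eq, Module.length_pi, Module.length_eq_one R, mul_one,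
    ← (torsionBySetTorsionBySet (map_maximalIdeal_le (algebraMap R S)) N).length_eq,
    (torsionBySetCongr _ e').length_eq, (torsionBySetPi _ _ _).length_eq, Module.length_pi]

/-- If a proper ideal `J` of a Noetherian local ring of dimension at most one contains a
nonzerodivisor, then the socle of the quotient by `J` is nonzero. -/
theorem socle_quotient_nontrivial [IsLocalRing R] [IsNoetherianRing R] [Ring.KrullDimLE 1 R]
    {J : Ideal R} (hJ : J ≠ ⊤) {y : R} (hy : y ∈ J) (hreg : y ∈ nonZeroDivisors R) :
    Nontrivial (Submodule.torsionBySet R (R ⧸ J) (maximalIdeal R : Set R)) := by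
  have : Nontrivial (R ⧸ J) := Ideal.Quotient.nontrivial_iff.2 hJ
  obtain ⟨p, hp⟩ := associatedPrimes.nonempty R (R ⧸ J)
  obtain ⟨hprime, x, rfl⟩ := isAssociatedPrime_iff.1 hp
  have hmem : y ∈ (⊥ : Submodule R (R ⧸ J)).colon {x} := by
    obtain ⟨x, rfl⟩ := Ideal.Quotient.mk_surjective x
    rw [Submodule.mem_colon_singleton, Submodule.mem_bot, ← Ideal.Quotient.mk_eq_mk,
      ← Submodule.Quotient.mk_smul, Submodule.Quotient.mk_eq_zero]
    exact J.mul_mem_right x hy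
  have hmax : ((⊥ : Submodule R (R ⧸ J)).colon {x}).IsMaximal :=
    (Ring.krullDimLE_one_iff.1 ‹_› _ hprime).resolve_left fun h ↦
      Set.disjoint_left.1 (Ideal.disjoint_nonZeroDivisors_of_mem_minimalPrimes h) hmem hreg
  have hx : x ∈ Submodule.torsionBySet R (R ⧸ J) (maximalIdeal R : Set R) := by
    rw [Submodule.mem_torsionBySet_iff]
    rintro ⟨a, ha⟩
    rw [SetLike.mem_coe, ← eq_maximalIdeal hmax] at ha
    exact Submodule.mem_colon_singleton.1 ha
  refine ⟨⟨x, hx⟩, 0, fun h ↦ hprime.ne_top ?_⟩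
  have hx0 : x = 0 := congrArg Subtype.val h
  rw [Ideal.eq_top_iff_one, Submodule.mem_colon_singleton, hx0]
  simp

/-- For flat `S` over `R`, the base change of an ideal is its extension. -/
noncomputable def idealBaseChangeEquiv (S : Type*) [CommRing S] [Algebra R S] [Module.Flat R S]
    (I : Ideal R) : S ⊗[R] I ≃ₗ[S] I.map (algebraMap R S) :=
  LinearEquiv.ofInjective ((TensorProduct.AlgebraTensorModule.rid R S S).toLinearMap ∘ₗ
      (Submodule.subtype I).baseChange S)
      ((TensorProduct.AlgebraTensorModule.rid R S S).injective.comp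
        (Module.Flat.lTensor_preserves_injective_linearMap _ (Submodule.subtype_injective _))) ≪≫ₗ
    LinearEquiv.ofEq _ _ (by
      refine le_antisymm ?_ (Ideal.map_le_iff_le_comap.2 fun a ha ↦
        ⟨1 ⊗ₜ ⟨a, ha⟩, by simp [Algebra.smul_def]⟩)
      rintro _ ⟨z, rfl⟩
      induction z with
      | zero => simp
      | add x y hx hy => rw [map_add]; exact add_mem hx hy
      | tmul s a =>
        simpa [Algebra.smul_def] using
          Ideal.mul_mem_right s _ (Ideal.mem_map_of_mem (algebraMap R S) a.2))

end Socle

section Ext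

/-- The homology of a short complex of modules is the image of its cycles under any linear map
which vanishes exactly on the boundaries. -/
theorem nonempty_homology_equiv_map_ker {R : Type u} [CommRing R]
    (C : ShortComplex (ModuleCat.{u} R))
    {N : Type u} [AddCommGroup N] [Module R N] (e : C.X₂ →ₗ[R] N)
    (he : ∀ z, C.g.hom z = 0 → (e z = 0 ↔ ∃ a, C.f.hom a = z)) :
    Nonempty (C.homology ≃ₗ[R] (LinearMap.ker C.g.hom).map e) := by
  let q : LinearMap.ker C.g.hom →ₗ[R] N := e ∘ₗ (LinearMap.ker C.g.hom).subtype
  have hker : LinearMap.range C.moduleCatToCycles = LinearMap.ker q := by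
    ext ⟨z, hz⟩
    rw [LinearMap.mem_ker]
    refine Iff.trans ?_ (he z hz).symm
    rw [LinearMap.mem_range]
    exact exists_congr fun a ↦ Subtype.ext_iff
  exact ⟨C.moduleCatHomologyIso.toLinearEquiv ≪≫ₗ
    Submodule.quotEquivOfEq _ _ hker ≪≫ₗ q.quotKerEquivRange ≪≫ₗ
    LinearEquiv.ofEq _ _ (by rw [LinearMap.range_comp, Submodule.range_subtype])⟩

section

variable {R : Type*} [CommRing R] {J : Ideal R} {P₀ P₁ P₂ M : Type*}
  [AddCommGroup P₀] [Module R P₀] [AddCommGroup P₁] [Module R P₁]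
  [AddCommGroup P₂] [Module R P₂] [AddCommGroup M] [Module R M]
  {d₂ : P₂ →ₗ[R] P₁} {d₁ : P₁ →ₗ[R] P₀} {π : P₀ →ₗ[R] R ⧸ J}

/-- A cocycle whose value at `w` is divisible by `y` is a coboundary, where `w` lifts `y` times a
generator of `R/J`. -/
theorem exists_comp_eq_of_apply_mem (h₁ : Function.Exact d₂ d₁) (h₀ : Function.Exact d₁ π)
    {y : R} (hy : y ∈ J) (hreg : IsSMulRegular M y) {e₀ : P₀} (he₀ : π e₀ = Submodule.Quotient.mk 1)
    {w : P₁} (hw : d₁ w = y • e₀) {φ : P₁ →ₗ[R] M} (hφ : φ ∘ₗ d₂ = 0) {z : M}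
    (hz : φ w = y • z) : ∃ g : P₀ →ₗ[R] M, g ∘ₗ d₁ = φ := by
  have hker : ∀ v, d₁ v = 0 → φ v = 0 := fun v hv ↦ by
    obtain ⟨t, rfl⟩ := (h₁ v).1 hv
    exact LinearMap.congr_fun hφ t
  have hdecomp : ∀ p : P₀, ∃ (r : R) (v : P₁), p = r • e₀ + d₁ v := fun p ↦ by
    obtain ⟨r, hr⟩ := Submodule.Quotient.mk_surjective J (π p)
    obtain ⟨v, hv⟩ := (h₀ (p - r • e₀)).1 (by
      rw [map_sub, map_smul, he₀, ← Submodule.Quotient.mk_smul, smul_eq_mul, mul_one, hr, sub_self])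
    exact ⟨r, v, by rw [hv]; abel⟩
  have hval : ∀ p : P₀, ∃ m : M, ∀ u, d₁ u = y • p → φ u = y • m := fun p ↦ by
    obtain ⟨r, v, rfl⟩ := hdecomp p
    refine ⟨r • z + φ v, fun u hu ↦ ?_⟩
    have := hker (u - (r • w + y • v)) (by
      rw [map_sub, map_add, map_smul, map_smul, hw, hu, smul_add, smul_comm r y, sub_self])
    rw [map_sub, sub_eq_zero] at this
    rw [this, map_add, map_smul, map_smul, hz, smul_add, smul_comm r y]
  have hlift : ∀ p : P₀, ∃ u, d₁ u = y • p := fun p ↦ (h₀ _).1 (by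
    obtain ⟨r, hr⟩ := Submodule.Quotient.mk_surjective J (π p)
    rw [map_smul, ← hr, ← Submodule.Quotient.mk_smul, Submodule.Quotient.mk_eq_zero]
    exact J.mul_mem_right r hy)
  choose g hg using hval
  choose l hl using hlift
  refine ⟨⟨⟨g, fun p q ↦ hreg ?_⟩, fun r p ↦ hreg ?_⟩, LinearMap.ext fun v ↦ hreg ?_⟩
  · dsimp only
    rw [smul_add, ← hg p _ (hl p), ← hg q _ (hl q), ← map_add]
    exact (hg _ _ (by rw [map_add, hl, hl, smul_add])).symm
  · dsimp only [RingHom.id_apply]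
    rw [smul_comm y r, ← hg p _ (hl p), ← map_smul]
    exact (hg _ _ (by rw [map_smul, hl, smul_comm])).symm
  · exact (hg _ (y • v) (map_smul _ _ _)).symm.trans (map_smul _ _ _)

/-- The values at `w` of cocycles are exactly the elements of `M` which `J` multiplies into `yM`,
where `w` lifts `y` times a generator of `R/J`. -/
theorem exists_cocycle_iff [Module.Projective R P₀]
    (h₁ : Function.Exact d₂ d₁) (h₀ : Function.Exact d₁ π)
    {y : R} (hreg : IsSMulRegular M y) {e₀ : P₀} (he₀ : π e₀ = Submodule.Quotient.mk 1)
    {w : P₁} (hw : d₁ w = y • e₀) (u : QuotSMulTop y M) :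
    (∃ φ : P₁ →ₗ[R] M, φ ∘ₗ d₂ = 0 ∧ Submodule.Quotient.mk (φ w) = u) ↔
      u ∈ Submodule.torsionBySet R (QuotSMulTop y M) (J : Set R) := by
  rw [Submodule.mem_torsionBySet_iff]
  constructor
  · rintro ⟨φ, hφ, rfl⟩ ⟨r, hr⟩
    obtain ⟨v, hv⟩ := (h₀ (r • e₀)).1 (by
      rw [map_smul, he₀, ← Submodule.Quotient.mk_smul, smul_eq_mul, mul_one]
      exact (Submodule.Quotient.mk_eq_zero J).2 hr)
    obtain ⟨t, ht⟩ := (h₁ (r • w - y • v)).1 (by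
      rw [map_sub, map_smul, map_smul, hw, hv, smul_comm, sub_self])
    have h : φ (r • w - y • v) = 0 := ht ▸ LinearMap.congr_fun hφ t
    rw [map_sub, map_smul, map_smul, sub_eq_zero] at h
    rw [← Submodule.Quotient.mk_smul, h, Submodule.Quotient.mk_eq_zero]
    exact Submodule.smul_mem_pointwise_smul _ _ _ trivial
  · intro hu
    obtain ⟨m, rfl⟩ := Submodule.Quotient.mk_surjective _ u
    obtain ⟨s, hs⟩ := Module.projective_lifting_property J.mkQ π J.mkQ_surjective
    have hs' : ∀ p, Submodule.Quotient.mk (s p) = π p := LinearMap.congr_fun hs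
    have hdiv : ∀ r ∈ J, ∃ n : M, y • n = r • m := fun r hr ↦ by
      have := hu ⟨r, hr⟩
      rw [← Submodule.Quotient.mk_smul, Submodule.Quotient.mk_eq_zero] at this
      obtain ⟨n, -, hn⟩ := this
      exact ⟨n, hn⟩
    have hsd : ∀ v, s (d₁ v) ∈ J := fun v ↦ by
      rw [← Submodule.Quotient.mk_eq_zero J, hs']
      exact h₀.apply_apply_eq_zero v
    choose f hf using fun v ↦ hdiv _ (hsd v)
    let φ : P₁ →ₗ[R] M :=
      { toFun := f
        map_add' := fun a b ↦ hreg <| by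
          dsimp only
          rw [hf, smul_add, hf, hf, map_add, map_add, add_smul]
        map_smul' := fun r a ↦ hreg <| by
          dsimp only [RingHom.id_apply]
          rw [hf, smul_comm y r, hf, map_smul, map_smul, smul_assoc] }
    refine ⟨φ, LinearMap.ext fun t ↦ hreg ?_, ?_⟩
    · change y • f (d₂ t) = y • 0
      rw [hf, h₁.apply_apply_eq_zero, map_zero, zero_smul, smul_zero]
    · have h1 : s e₀ - 1 ∈ J := by
        rw [← Submodule.Quotient.mk_eq_zero J, Submodule.Quotient.mk_sub, hs', he₀, sub_self]
      have h2 : φ w = s e₀ • m := hreg <| by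
        change y • f w = y • s e₀ • m
        rw [hf, hw, map_smul, smul_assoc]
      obtain ⟨n, hn⟩ := hdiv _ h1
      rw [sub_smul, one_smul] at hn
      rw [h2, Submodule.Quotient.eq, ← hn]
      exact Submodule.smul_mem_pointwise_smul _ _ _ trivial

end

/-- If `y ∈ J` is regular on `M` then `Ext¹(R/J, M)` is the `J`-torsion of `M/yM`. -/
theorem nonempty_ext_one_equiv {R : Type u} [CommRing R] {J : Ideal R} {y : R} (hy : y ∈ J)
    {M : ModuleCat.{u} R} (hreg : IsSMulRegular M y) :
    Nonempty ((((_root_.Ext R (ModuleCat.{u} R) 1).obj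
      (Opposite.op (ModuleCat.of R (R ⧸ J)))).obj M) ≃ₗ[R]
        Submodule.torsionBySet R (QuotSMulTop y M) (J : Set R)) := by
  let P := projectiveResolution (ModuleCat.of R (R ⧸ J))
  have h₁ : Function.Exact (P.complex.d 2 1).hom (P.complex.d 1 0).hom :=
    (ShortComplex.ShortExact.moduleCat_exact_iff_function_exact _).1 (P.exact_succ 0)
  have h₀ : Function.Exact (P.complex.d 1 0).hom (P.π.f 0).hom :=
    (ShortComplex.ShortExact.moduleCat_exact_iff_function_exact _).1 P.exact₀
  let π : P.complex.X 0 →ₗ[R] R ⧸ J := (P.π.f 0).hom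
  have hsurj : Function.Surjective π := (ModuleCat.epi_iff_surjective (P.π.f 0)).1 inferInstance
  have : Module.Projective R (P.complex.X 0) :=
    (IsProjective.iff_projective _).2 (P.projective 0)
  obtain ⟨e₀, he₀⟩ := hsurj (Submodule.Quotient.mk 1)
  obtain ⟨w, hw⟩ := (h₀ (y • e₀)).1 (by
    change π (y • e₀) = 0
    rw [map_smul, he₀, ← Submodule.Quotient.mk_smul, smul_eq_mul, mul_one]
    exact (Submodule.Quotient.mk_eq_zero J).2 hy)
  let K := P.complex.linearYonedaObj R M
  let e : (P.complex.X 1 ⟶ M) →ₗ[R] QuotSMulTop y M :=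
    { toFun := fun φ ↦ Submodule.Quotient.mk (φ.hom w)
      map_add' := fun _ _ ↦ rfl
      map_smul' := fun _ _ ↦ rfl }
  have hg : ∀ φ : P.complex.X 1 ⟶ M,
      (K.sc' 0 1 2).g.hom φ = 0 ↔ φ.hom ∘ₗ (P.complex.d 2 1).hom = 0 :=
    fun _ ↦ ModuleCat.hom_ext_iff
  obtain ⟨E⟩ := nonempty_homology_equiv_map_ker (K.sc' 0 1 2) e fun (φ : P.complex.X 1 ⟶ M) hφ ↦ by
    constructor
    · intro h
      obtain ⟨z, -, hz⟩ := (Submodule.Quotient.mk_eq_zero _).1 h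
      obtain ⟨g, hg'⟩ := exists_comp_eq_of_apply_mem h₁ h₀ hy hreg he₀ hw ((hg φ).1 hφ) hz.symm
      exact ⟨ModuleCat.ofHom g, ModuleCat.hom_ext hg'⟩
    · rintro ⟨g, rfl⟩
      refine (Submodule.Quotient.mk_eq_zero _).2 ?_
      change g.hom ((P.complex.d 1 0).hom w) ∈ _
      rw [hw, map_smul]
      exact Submodule.smul_mem_pointwise_smul _ _ _ trivial
  refine ⟨(P.isoExt 1 M ≪≫ K.homologyIsoSc' 0 1 2 (by simp) (by simp)).toLinearEquiv ≪≫ₗ E ≪≫ₗ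
    LinearEquiv.ofEq _ _ ?_⟩
  ext u
  rw [← exists_cocycle_iff h₁ h₀ hreg he₀ hw]
  constructor
  · rintro ⟨φ, hφ, rfl⟩
    exact ⟨ModuleCat.Hom.hom φ, (hg φ).1 hφ, rfl⟩
  · rintro ⟨φ, hφ, rfl⟩
    exact ⟨ModuleCat.ofHom φ, (hg (ModuleCat.ofHom φ)).2 hφ, rfl⟩

end Ext

section Elias

variable {R : Type u} [CommRing R] [IsLocalRing R]

theorem quotType_eq_length_socle (I : Ideal R) :
    quotType R I =
      Module.length R (Submodule.torsionBySet R (R ⧸ I) (maximalIdeal R : Set R)) := by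
  rw [← (quotientHomEquivTorsion (maximalIdeal R) (R ⧸ I)).length_eq, Module.coe_length]
  rfl

theorem idealType_eq_length_socle (I : Ideal R) {y : R} (hy : y ∈ maximalIdeal R)
    (hreg : y ∈ nonZeroDivisors R) :
    idealType R I =
      Module.length R
        (Submodule.torsionBySet R (QuotSMulTop y I) (maximalIdeal R : Set R)) := by
  obtain ⟨e⟩ := nonempty_ext_one_equiv hy (M := ModuleCat.of R I)
    fun a b h ↦ Subtype.ext
      (Module.Flat.isSMulRegular_of_nonZeroDivisors (M := R) hreg (congrArg Subtype.val h))
  exact (Module.coe_length ..).symm.trans (congrArg _ e.length_eq)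

end Elias

theorem elias_flat_base_change (R : Type u) [CommRing R] [IsLocalRing R] [IsNoetherianRing R]
    (hdim : ringKrullDim R = 1)
    (hCM : ∃ x ∈ maximalIdeal R, x ∈ nonZeroDivisors R)
    (S : Type u) [CommRing S] [IsLocalRing S] [IsNoetherianRing S]
    [Algebra R S] [Module.Flat R S] (hloc : IsLocalHom (algebraMap R S))
    (hdimS : ringKrullDim S = 1)
    (I : Ideal R) (hI : IsMPrimary R I) :
    EliasIdeal R I ↔ EliasIdeal S (I.map (algebraMap R S)) := by
  obtain ⟨y, hy, hreg⟩ := hCM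
  have hy' : algebraMap R S y ∈ (maximalIdeal R).map (algebraMap R S) := Ideal.mem_map_of_mem _ hy
  have hle := map_maximalIdeal_le (algebraMap R S)
  have hreg' : algebraMap R S y ∈ nonZeroDivisors S := by
    refine mem_nonZeroDivisors_iff_right.2 fun s hs ↦
      Module.Flat.isSMulRegular_of_nonZeroDivisors (M := S) hreg ?_
    simpa [Algebra.smul_def, mul_comm] using hs
  have : Ring.KrullDimLE 1 S := Ring.krullDimLE_iff.2 hdimS.le
  have hnontrivial := socle_quotient_nontrivial
    (ne_top_of_le_ne_top (maximalIdeal.isMaximal S).ne_top hle) hy' hreg'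
  have hquot := length_socle_baseChange (Ideal.qoutMapEquivTensorQout S (I := I)).symm
  have hideal := length_socle_baseChange
    ((QuotSMulTop.algebraMapTensorEquivTensorQuotSMulTop y I S).symm ≪≫ₗ
      QuotSMulTop.congr (algebraMap R S y) (idealBaseChangeEquiv S I))
  rw [EliasIdeal, EliasIdeal, quotType_eq_length_socle, quotType_eq_length_socle,
    idealType_eq_length_socle I hy hreg, idealType_eq_length_socle _ (hle hy') hreg',
    WithBot.coe_inj, WithBot.coe_inj, hquot, hideal]
  exact (ENat.mul_left_strictMono (Module.length_pos_iff.2 hnontrivial).ne'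
    (length_socle_ne_top _)).injective.eq_iff.symm
end

section
/- Let (R, m) be a one-dimensional Cohen-Macaulay local ring with e(R) = 2 and infinite residue field. Then an m-primary ideal I is Elias if and only if I ⊆ (x) for some non-zerodivisor x ∈ m. -/
open CategoryTheory IsLocalRing

universe u

theorem exists_smul_eq_of_forall_mem_range {R P M : Type*} [CommRing R] [AddCommGroup P]
    [AddCommGroup M] [Module R P] [Module R M] {x : R}
    (hx : Function.Injective (LinearMap.lsmul R M x))
    (h : P →ₗ[R] M) (hh : ∀ p, h p ∈ LinearMap.range (LinearMap.lsmul R M x)) :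
    ∃ f : P →ₗ[R] M, ∀ p, x • f p = h p := by
  refine ⟨(LinearEquiv.ofInjective _ hx).symm.toLinearMap ∘ₗ h.codRestrict _ hh, fun p => ?_⟩
  exact congrArg Subtype.val
    ((LinearEquiv.ofInjective _ hx).apply_symm_apply (h.codRestrict _ hh p))

section

variable {R : Type*} [CommRing R] {P₀ P₁ P₂ X M : Type*} [AddCommGroup P₀] [AddCommGroup P₁]
  [AddCommGroup P₂] [AddCommGroup X] [AddCommGroup M] [Module R P₀] [Module R P₁] [Module R P₂]
  [Module R X] [Module R M] {d₂ : P₂ →ₗ[R] P₁} {d₁ : P₁ →ₗ[R] P₀} {e : P₀ →ₗ[R] X}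
  {x : R} {s : P₀ →ₗ[R] P₁}

theorem mkQ_comp_eq_zero_iff (h₂ : Function.Exact d₂ d₁)
    (hx : Function.Injective (LinearMap.lsmul R M x)) (hs : ∀ p, d₁ (s p) = x • p)
    (f : P₁ →ₗ[R] M) (hf : f ∘ₗ d₂ = 0) :
    (LinearMap.range (LinearMap.lsmul R M x)).mkQ ∘ₗ f ∘ₗ s = 0 ↔
      ∃ g : P₀ →ₗ[R] M, g ∘ₗ d₁ = f := by
  constructor
  · intro h
    obtain ⟨g, hg⟩ := exists_smul_eq_of_forall_mem_range hx (f ∘ₗ s) fun p => by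
      simpa [Submodule.Quotient.mk_eq_zero] using LinearMap.congr_fun h p
    refine ⟨g, LinearMap.ext fun q => hx ?_⟩
    obtain ⟨r, hr⟩ := (h₂ (s (d₁ q) - x • q)).1 (by simp [hs])
    have := LinearMap.congr_fun hf r
    simp only [LinearMap.comp_apply, hr, map_sub, map_smul, LinearMap.zero_apply,
      sub_eq_zero] at this
    simpa [hg] using this
  · rintro ⟨g, rfl⟩
    ext p
    exact (Submodule.Quotient.mk_eq_zero _).2 ⟨g p, by simp [hs]⟩

theorem exists_mkQ_comp_eq_iff [Module.Projective R P₀] (h₂ : Function.Exact d₂ d₁)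
    (h₁ : Function.Exact d₁ e) (he : Function.Surjective e)
    (hx : Function.Injective (LinearMap.lsmul R M x)) (hs : ∀ p, d₁ (s p) = x • p)
    (k : P₀ →ₗ[R] M ⧸ LinearMap.range (LinearMap.lsmul R M x)) :
    (∃ f : P₁ →ₗ[R] M, f ∘ₗ d₂ = 0 ∧
      (LinearMap.range (LinearMap.lsmul R M x)).mkQ ∘ₗ f ∘ₗ s = k) ↔
      ∃ φ : X →ₗ[R] M ⧸ LinearMap.range (LinearMap.lsmul R M x), φ ∘ₗ e = k := by
  constructor
  · rintro ⟨f, hf, rfl⟩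
    refine ⟨(LinearMap.ker e).liftQ
      ((LinearMap.range (LinearMap.lsmul R M x)).mkQ ∘ₗ f ∘ₗ s) ?_ ∘ₗ
        (e.quotKerEquivOfSurjective he).symm.toLinearMap, ?_⟩
    · intro p hp
      obtain ⟨q, rfl⟩ := (h₁ p).1 hp
      obtain ⟨r, hr⟩ := (h₂ (s (d₁ q) - x • q)).1 (by simp [hs])
      have := LinearMap.congr_fun hf r
      simp only [LinearMap.comp_apply, hr, map_sub, map_smul, LinearMap.zero_apply,
        sub_eq_zero] at this
      exact (Submodule.Quotient.mk_eq_zero _).2 ⟨f q, by simp [this]⟩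
    · ext p
      have : (e.quotKerEquivOfSurjective he).symm (e p) = (LinearMap.ker e).mkQ p := by
        rw [LinearEquiv.symm_apply_eq]; rfl
      simp [this]
  · rintro ⟨φ, rfl⟩
    obtain ⟨h, hh⟩ := Module.projective_lifting_property
      (LinearMap.range (LinearMap.lsmul R M x)).mkQ (φ ∘ₗ e) (Submodule.mkQ_surjective _)
    obtain ⟨f, hf⟩ := exists_smul_eq_of_forall_mem_range hx (h ∘ₗ d₁) fun q => by
      have := LinearMap.congr_fun hh (d₁ q)
      simpa [h₁.apply_apply_eq_zero, Submodule.Quotient.mk_eq_zero] using this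
    refine ⟨f, LinearMap.ext fun r => hx ?_, ?_⟩
    · simp [hf, h₂.apply_apply_eq_zero]
    · rw [← hh]
      congr 1
      ext p
      apply hx
      simp [hf, hs]

end


/-- If `x` is regular on `M` and kills `X`, then `Ext^1(X, M) ≃ Hom(X, M / xM)`. -/
theorem nonempty_ext_one_linearEquiv_s12 {R : Type u} [CommRing R] (X M : ModuleCat.{u} R) {x : R}
    (hx : Function.Injective (LinearMap.lsmul R M x)) (hX : ∀ y : X, x • y = 0) :
    Nonempty (((_root_.Ext R (ModuleCat.{u} R) 1).obj (Opposite.op X)).obj M ≃ₗ[R]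
      (X →ₗ[R] M ⧸ LinearMap.range (LinearMap.lsmul R M x))) := by
  let P := projectiveResolution X
  let e : P.complex.X 0 →ₗ[R] X := (P.π.f 0).hom
  have h₂ : Function.Exact (P.complex.d 2 1).hom (P.complex.d 1 0).hom :=
    (ShortComplex.ShortExact.moduleCat_exact_iff_function_exact _).1 (P.exact_succ 0)
  have h₁ : Function.Exact (P.complex.d 1 0).hom e :=
    (ShortComplex.ShortExact.moduleCat_exact_iff_function_exact _).1 P.exact₀
  have he : Function.Surjective e :=
    (ModuleCat.epi_iff_surjective (P.π.f 0)).1 inferInstance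
  have : Module.Projective R (P.complex.X 0) := by
    rw [IsProjective.iff_projective]
    exact P.projective 0
  obtain ⟨s, hs⟩ : ∃ s : P.complex.X 0 →ₗ[R] P.complex.X 1,
      ∀ p, (P.complex.d 1 0).hom (s p) = x • p := by
    obtain ⟨s, hs⟩ := Module.projective_lifting_property
      (P.complex.d 1 0).hom.rangeRestrict ((LinearMap.lsmul R _ x).codRestrict
        (LinearMap.range (P.complex.d 1 0).hom) fun p => (h₁ _).1 (by simp [hX]))
      (LinearMap.surjective_rangeRestrict _)
    exact ⟨s, fun p => congrArg Subtype.val (LinearMap.congr_fun hs p)⟩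
  let K := P.complex.linearYonedaObj R M
  let S := K.sc' 0 1 2
  have E : ((_root_.Ext R (ModuleCat.{u} R) 1).obj (Opposite.op X)).obj M ≅
      S.moduleCatLeftHomologyData.H :=
    P.isoExt 1 M ≪≫ K.homologyIsoSc' 0 1 2 (by simp) (by simp) ≪≫ S.moduleCatHomologyIso
  let N := M ⧸ LinearMap.range (LinearMap.lsmul R M x)
  let ψ : LinearMap.ker S.g.hom →ₗ[R] (P.complex.X 0 →ₗ[R] N) :=
    (LinearMap.llcomp R _ M N (LinearMap.range (LinearMap.lsmul R M x)).mkQ) ∘ₗ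
    (LinearMap.lcomp R M s) ∘ₗ (ModuleCat.homLinearEquiv (S := R)).toLinearMap ∘ₗ
      (LinearMap.ker S.g.hom).subtype
  have hψ : LinearMap.range S.moduleCatToCycles = LinearMap.ker ψ := by
    ext f
    have hf : f.1.hom ∘ₗ (P.complex.d 2 1).hom = 0 := congrArg ModuleCat.Hom.hom f.2
    rw [LinearMap.mem_ker]
    refine Iff.trans ?_ (mkQ_comp_eq_zero_iff h₂ hx hs _ hf).symm
    constructor
    · rintro ⟨g, rfl⟩
      exact ⟨g.hom, rfl⟩
    · rintro ⟨g, hg⟩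
      exact ⟨ModuleCat.ofHom g, Subtype.ext (ModuleCat.hom_ext hg)⟩
  have hr : LinearMap.range ψ = LinearMap.range (LinearMap.lcomp R N e) := by
    ext k
    refine Iff.trans ?_ (exists_mkQ_comp_eq_iff h₂ h₁ he hx hs k)
    constructor
    · rintro ⟨f, rfl⟩
      exact ⟨f.1.hom, congrArg ModuleCat.Hom.hom f.2, rfl⟩
    · rintro ⟨f, hf, rfl⟩
      exact ⟨⟨ModuleCat.ofHom f, ModuleCat.hom_ext hf⟩, rfl⟩
  exact ⟨E.toLinearEquiv ≪≫ₗ Submodule.quotEquivOfEq _ _ hψ ≪≫ₗ ψ.quotKerEquivRange ≪≫ₗ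
    LinearEquiv.ofEq _ _ hr ≪≫ₗ (LinearEquiv.ofInjective (LinearMap.lcomp R N e)
      (LinearMap.lcomp_injective_of_surjective e he)).symm⟩

section

variable {R : Type*} [CommRing R]

theorem length_quotient_add_one_le {J K : Ideal R} (h : J < K) :
    Module.length R (R ⧸ K) + 1 ≤ Module.length R (R ⧸ J) := by
  have hs : Function.Surjective (Submodule.factor h.le) := Submodule.factor_surjective h.le
  rw [Module.length_eq_add_of_exact _ _ (Submodule.subtype_injective _) hs
    (LinearMap.exact_subtype_ker_map (Submodule.factor h.le)), add_comm]
  gcongr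
  obtain ⟨a, haK, haJ⟩ := SetLike.exists_of_lt h
  have : Nontrivial (LinearMap.ker (Submodule.factor h.le)) :=
    ⟨⟨⟨Submodule.Quotient.mk a, (Submodule.Quotient.mk_eq_zero K).2 haK⟩, 0, fun h => haJ <|
      (Submodule.Quotient.mk_eq_zero J).1 (congrArg Subtype.val h)⟩⟩
  exact Order.one_le_iff_pos.2 Module.length_pos

theorem length_quotient_span_singleton_mul {z : R} (hz : z ∈ nonZeroDivisors R) (J : Ideal R) :
    Module.length R (R ⧸ Ideal.span {z} * J) =
      Module.length R (R ⧸ J) + Module.length R (R ⧸ Ideal.span {z}) := by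
  have := Module.length_eq_add_of_exact _ _ (Ideal.mulQuot_injective J hz)
    (Ideal.quotOfMul_surjective J) (Ideal.exact_mulQuot_quotOfMul J)
  rwa [← Submodule.ideal_span_singleton_smul, smul_eq_mul] at this

theorem length_quotient_ne_top_of_pow_le [IsLocalRing R] [IsNoetherianRing R] {J : Ideal R} {n : ℕ}
    (h : maximalIdeal R ^ n ≤ J) : Module.length R (R ⧸ J) ≠ ⊤ := by
  obtain rfl | hJ := eq_or_ne J ⊤
  · simp [Module.length_eq_zero]
  have : Nontrivial (R ⧸ J) := Ideal.Quotient.nontrivial_iff.2 hJ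
  have : IsLocalRing (R ⧸ J) := .of_surjective' _ Ideal.Quotient.mk_surjective
  have : IsArtinianRing (R ⧸ J) := by
    rw [isArtinianRing_iff_isNilpotent_maximalIdeal]
    refine ⟨n, ?_⟩
    have : maximalIdeal (R ⧸ J) = (maximalIdeal R).map (Ideal.Quotient.mk J) := by
      rw [← Ideal.map_comap_of_surjective _ Ideal.Quotient.mk_surjective (maximalIdeal (R ⧸ J))]
      congr 1
      have := IsLocalRing.of_surjective' _ (Ideal.Quotient.mk_surjective (I := J))
      exact eq_maximalIdeal (Ideal.comap_isMaximal_of_surjective _ Ideal.Quotient.mk_surjective)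
    rw [this, ← Ideal.map_pow, Ideal.zero_eq_bot, Ideal.map_mk_eq_bot_of_le h]
  have : IsArtinian R (R ⧸ J) :=
    isArtinian_of_surjective_algebraMap (Ideal.Quotient.mk_surjective (I := J))
  exact Module.length_ne_top

theorem length_quotient_le_length_quotient_sup_add_one [IsLocalRing R] {C : Ideal R} {w : R}
    (hw : ∀ y ∈ maximalIdeal R, y * w ∈ C) :
    Module.length R (R ⧸ C) ≤ Module.length R (R ⧸ Ideal.span {w} ⊔ C) + 1 := by
  let g : R ⧸ maximalIdeal R →ₗ[R] R ⧸ C :=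
    (maximalIdeal R).liftQ (LinearMap.toSpanSingleton R _ (Submodule.Quotient.mk w)) fun y hy => by
      exact (Submodule.Quotient.mk_eq_zero C).2 (hw y hy)
  have hle : C ≤ Ideal.span {w} ⊔ C := le_sup_right
  have hex : Function.Exact (LinearMap.range g).subtype (Submodule.factor hle) := by
    intro y
    obtain ⟨y, rfl⟩ := Submodule.Quotient.mk_surjective _ y
    rw [show Submodule.factor hle (Submodule.Quotient.mk y) = Submodule.Quotient.mk y from rfl,
      Submodule.Quotient.mk_eq_zero, Ideal.mem_span_singleton_sup]
    constructor
    · rintro ⟨a, c, hc, rfl⟩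
      refine ⟨⟨_, Submodule.Quotient.mk a, rfl⟩, ?_⟩
      refine (Submodule.Quotient.eq C).2 ?_
      simpa using hc
    · rintro ⟨⟨_, a, rfl⟩, h⟩
      obtain ⟨a, rfl⟩ := Submodule.Quotient.mk_surjective _ a
      exact ⟨a, y - a * w, (Submodule.Quotient.eq C).1 h.symm, by ring⟩
  rw [Module.length_eq_add_of_exact _ _ (Submodule.subtype_injective _)
    (Submodule.factor_surjective hle) hex, add_comm]
  gcongr
  refine (Module.length_le_of_surjective _ g.surjective_rangeRestrict).trans ?_
  have : IsSimpleModule R (R ⧸ maximalIdeal R) :=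
    isSimpleModule_iff_isCoatom.2 (maximalIdeal.isMaximal R).out
  rw [Module.length_eq_one]

theorem eq_of_lt_of_lt_of_le {B C : Ideal R}
    (hC : Module.length R (R ⧸ C) = Module.length R (R ⧸ B) + 2)
    (hfin : Module.length R (R ⧸ B) ≠ ⊤) {P Q : Ideal R} (h₁ : C < P) (h₂ : P < Q) (h₃ : Q ≤ B) :
    Q = B := by
  by_contra h
  have a := length_quotient_add_one_le h₁
  have b := length_quotient_add_one_le h₂
  have c := length_quotient_add_one_le (lt_of_le_of_ne h₃ h)
  have key : Module.length R (R ⧸ B) + 1 + 1 + 1 ≤ Module.length R (R ⧸ B) + 2 := by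
    rw [← hC]
    refine le_trans ?_ a
    gcongr
    refine le_trans ?_ b
    gcongr
  generalize Module.length R (R ⧸ B) = δ at *
  lift δ to ℕ using hfin
  norm_cast at key
  omega

end

theorem linearMap_residueField_ext {R M : Type*} [CommRing R] [IsLocalRing R] [AddCommGroup M]
    [Module R M] {φ ψ : ResidueField R →ₗ[R] M} (h : φ 1 = ψ 1) : φ = ψ := by
  ext y
  obtain ⟨r, rfl⟩ := residue_surjective y
  have hr : residue R r = r • (1 : ResidueField R) := by
    rw [Algebra.smul_def, mul_one]
    rfl
  rw [hr, map_smul, map_smul, h]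

theorem exists_linearMap_residueField (R : Type*) {M : Type*} [CommRing R] [IsLocalRing R]
    [AddCommGroup M] [Module R M] {a : M} (h : ∀ r ∈ maximalIdeal R, r • a = 0) :
    ∃ φ : ResidueField R →ₗ[R] M, φ 1 = a :=
  ⟨(maximalIdeal R).liftQ (LinearMap.toSpanSingleton R M a) h, one_smul R a⟩

theorem smul_linearMap_residueField_one {R M : Type*} [CommRing R] [IsLocalRing R]
    [AddCommGroup M] [Module R M] (φ : ResidueField R →ₗ[R] M) {r : R} (hr : r ∈ maximalIdeal R) :
    r • φ 1 = 0 := by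
  rw [← map_smul, Algebra.smul_def, mul_one, ResidueField.algebraMap_eq,
    (residue_eq_zero_iff r).2 hr, map_zero]

theorem length_linearMap_residueField_eq_iff {R M N : Type*} [CommRing R] [IsLocalRing R]
    [AddCommGroup M] [Module R M] [AddCommGroup N] [Module R N] (hfin : Module.length R M ≠ ⊤)
    {τ : M →ₗ[R] N} (hτ : Function.Injective τ) :
    Module.length R (ResidueField R →ₗ[R] N) = Module.length R (ResidueField R →ₗ[R] M) ↔
      ∀ b : N, (∀ r ∈ maximalIdeal R, r • b = 0) → b ∈ LinearMap.range τ := by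
  let T : (ResidueField R →ₗ[R] M) →ₗ[R] (ResidueField R →ₗ[R] N) := LinearMap.llcomp R _ _ _ τ
  have hT : Function.Injective T := fun φ ψ h => by
    ext
    exact hτ (LinearMap.congr_fun h _)
  have hfin' : Module.length R (ResidueField R →ₗ[R] M) ≠ ⊤ :=
    ne_top_of_le_ne_top hfin (Module.length_le_of_injective (LinearMap.applyₗ (1 : ResidueField R))
      fun _ _ => linearMap_residueField_ext)
  have hsurj : Module.length R (ResidueField R →ₗ[R] N) =
      Module.length R (ResidueField R →ₗ[R] M) ↔ Function.Surjective T := by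
    rw [Module.length_eq_add_of_exact T (LinearMap.range T).mkQ hT (Submodule.mkQ_surjective _)
      (LinearMap.exact_map_mkQ_range T), ← LinearMap.range_eq_top,
      ← Submodule.Quotient.subsingleton_iff, ← Module.length_eq_zero_iff (R := R)]
    generalize Module.length R (ResidueField R →ₗ[R] M) = α at *
    generalize Module.length R ((ResidueField R →ₗ[R] N) ⧸ LinearMap.range T) = β
    lift α to ℕ using hfin'
    cases β with
    | top => simp
    | coe β => norm_cast; omega
  refine hsurj.trans ⟨fun h b hb => ?_, fun h φ => ?_⟩
  · obtain ⟨φ, rfl⟩ := exists_linearMap_residueField R hb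
    obtain ⟨ψ, rfl⟩ := h φ
    exact ⟨ψ 1, rfl⟩
  · obtain ⟨a, ha⟩ := h (φ 1) fun r hr => smul_linearMap_residueField_one φ hr
    obtain ⟨ψ, hψ⟩ := exists_linearMap_residueField R (a := a) fun r hr => hτ (by
      rw [map_smul, ha, smul_linearMap_residueField_one φ hr, map_zero])
    exact ⟨ψ, linearMap_residueField_ext ((congrArg τ hψ).trans ha)⟩

theorem length_hom_eq_iff {R : Type u} [CommRing R] [IsLocalRing R] {I : Ideal R} {x : R}
    (hx : x ∈ nonZeroDivisors R) (hxI : x ∈ I) (hIm : I ≤ maximalIdeal R)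
    (hfin : Module.length R (R ⧸ I) ≠ ⊤) :
    Module.length R (ResidueField R →ₗ[R] I ⧸ LinearMap.range (LinearMap.lsmul R I x)) =
      Module.length R (ResidueField R →ₗ[R] R ⧸ I) ↔
      ∀ a : R, (∀ r ∈ maximalIdeal R, r * a ∈ Ideal.span {x} * I) → a ∈ Ideal.span {x} := by
  let N := I ⧸ LinearMap.range (LinearMap.lsmul R I x)
  have hN (a : I) : (Submodule.Quotient.mk a : N) = 0 ↔ (a : R) ∈ Ideal.span {x} * I := by
    rw [Submodule.Quotient.mk_eq_zero, Ideal.mem_span_singleton_mul]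
    constructor
    · rintro ⟨b, rfl⟩
      exact ⟨b, b.2, rfl⟩
    · rintro ⟨b, hb, h⟩
      exact ⟨⟨b, hb⟩, Subtype.ext h⟩
  let τ : R ⧸ I →ₗ[R] N := I.liftQ
    ((LinearMap.range (LinearMap.lsmul R I x)).mkQ ∘ₗ LinearMap.toSpanSingleton R I ⟨x, hxI⟩)
    fun a ha => by
      simp only [LinearMap.mem_ker]
      exact (hN _).2 (Ideal.mem_span_singleton_mul.2 ⟨a, ha, by simp [mul_comm]⟩)
  have hτ' (b : R) : τ (Submodule.Quotient.mk b) =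
      Submodule.Quotient.mk (b • (⟨x, hxI⟩ : I)) := rfl
  have hτ : Function.Injective τ := by
    rw [injective_iff_map_eq_zero]
    intro a
    obtain ⟨a, rfl⟩ := Submodule.Quotient.mk_surjective _ a
    intro h
    obtain ⟨b, hb, h⟩ := Ideal.mem_span_singleton_mul.1 ((hN _).1 h)
    rw [Submodule.Quotient.mk_eq_zero]
    convert hb
    simp only [LinearMap.toSpanSingleton_apply, Submodule.coe_smul, smul_eq_mul] at h
    exact (mul_cancel_left_mem_nonZeroDivisors hx).1 (by rw [h, mul_comm])
  refine (length_linearMap_residueField_eq_iff hfin hτ).trans ⟨fun h a ha => ?_, fun h b hb => ?_⟩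
  · have haI : a ∈ I := by
      obtain ⟨b, hb, h⟩ := Ideal.mem_span_singleton_mul.1 (ha x (hIm hxI))
      rwa [← (mul_cancel_left_mem_nonZeroDivisors hx).1 h]
    obtain ⟨b, hb⟩ := h (Submodule.Quotient.mk ⟨a, haI⟩) fun r hr =>
      (hN (r • (⟨a, haI⟩ : I))).2 (ha r hr)
    obtain ⟨b, rfl⟩ := Submodule.Quotient.mk_surjective _ b
    have h1 : b * x - a ∈ Ideal.span {x} * I := (hN (b • (⟨x, hxI⟩ : I) - ⟨a, haI⟩)).1
      ((Submodule.Quotient.mk_sub _).trans (sub_eq_zero.2 ((hτ' b).symm.trans hb)))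
    have h2 := (Ideal.span {x}).sub_mem (Ideal.mul_mem_left _ b (Ideal.mem_span_singleton_self x))
      (Ideal.mul_le_left h1)
    simpa using h2
  · obtain ⟨⟨a, haI⟩, rfl⟩ := Submodule.Quotient.mk_surjective _ b
    obtain ⟨b, rfl⟩ := Ideal.mem_span_singleton'.1 <| h a fun r hr =>
      (hN (r • (⟨a, haI⟩ : I))).1 (hb r hr)
    exact ⟨Submodule.Quotient.mk b, (hτ' b).trans (congrArg _ (Subtype.ext rfl))⟩

theorem exists_forall_colon_maximalIdeal_pow {R : Type*} [CommRing R] [IsNoetherianRing R]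
    {m : Ideal R} (hm : ∃ x ∈ m, x ∈ nonZeroDivisors R) :
    ∃ c, ∀ n ≥ c, ∀ a : R, (∀ y ∈ m, y * a ∈ m ^ (n + 2)) → a ∈ m ^ (n + 1) := by
  obtain ⟨S, rfl⟩ := IsNoetherian.noetherian m
  set m := Submodule.span R (S : Set R)
  obtain ⟨x, hxm, hx⟩ := hm
  let φ : R →ₗ[R] (S → R) := LinearMap.pi fun s => LinearMap.lsmul R R s
  have hspan {J : Ideal R} {a : R} (h : ∀ s ∈ S, s * a ∈ J) : ∀ y ∈ m, y * a ∈ J := fun y hy => by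
    induction hy using Submodule.span_induction with
    | mem y hy => exact h y hy
    | zero => simp
    | add y z _ _ hy hz => rw [add_mul]; exact J.add_mem hy hz
    | smul r y _ hy => rw [smul_mul_assoc]; exact J.mul_mem_left r hy
  have hφ : Function.Injective φ := by
    rw [injective_iff_map_eq_zero]
    intro a ha
    have : x * a ∈ (⊥ : Ideal R) := hspan (fun s hs => by
      simpa [φ] using congrFun ha ⟨s, hs⟩) x hxm
    simpa using (mul_cancel_left_mem_nonZeroDivisors hx).1 (this.trans (mul_zero x).symm)
  obtain ⟨k, hk⟩ := Ideal.exists_pow_inf_eq_pow_smul m (LinearMap.range φ)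
  refine ⟨k, fun n hn a ha => ?_⟩
  have hmem : φ a ∈ m ^ (n + 2) • (⊤ : Submodule R (S → R)) ⊓ LinearMap.range φ := by
    refine ⟨?_, a, rfl⟩
    classical
    rw [pi_eq_sum_univ (φ a)]
    exact Submodule.sum_mem _ fun s _ => Submodule.smul_mem_smul
      (ha s (Submodule.subset_span s.2)) trivial
  rw [hk (n + 2) (by omega), inf_comm, ← Submodule.map_comap_eq, ← Submodule.map_smul''] at hmem
  obtain ⟨b, hb, hab⟩ := hmem
  obtain rfl := hφ hab
  have hle : m • Submodule.comap φ (m ^ k • ⊤) ≤ m ^ k := by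
    rw [Submodule.smul_le]
    intro y hy l hl
    refine hspan (fun s hs => ?_) y hy
    have := Submodule.smul_top_le_comap_smul_top (m ^ k) (LinearMap.proj (⟨s, hs⟩ : S)) hl
    simpa [φ] using this
  have h2 : m ^ (n + 2 - k) = m ^ (n + 1 - k) * m := by
    rw [← pow_succ]; congr 1; omega
  rw [h2, mul_smul] at hb
  have := Submodule.smul_mono (le_refl (m ^ (n + 1 - k))) hle hb
  rwa [smul_eq_mul, ← pow_add, show n + 1 - k + k = n + 1 by omega] at this

section

variable {R : Type*} [CommRing R] [IsLocalRing R]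

theorem exists_span_singleton_mul_sup_eq {A B C : Ideal R} (hB : maximalIdeal R * A = B)
    (hC : maximalIdeal R * B = C)
    (hA₂ : ∀ P Q : Ideal R, B < P → P < Q → Q ≤ A → Q = A)
    (hB₂ : ∀ P Q : Ideal R, C < P → P < Q → Q ≤ B → Q = B)
    (hA₁ : ∀ v ∈ A, Ideal.span {v} ⊔ B ≠ A) (hB₁ : ∀ w ∈ B, Ideal.span {w} ⊔ C ≠ B)
    (hcolon : ∀ a ∈ A, (∀ y ∈ maximalIdeal R, y * a ∈ C) → a ∈ B) :
    ∃ z ∈ maximalIdeal R, Ideal.span {z} * A ⊔ C = B := by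
  have hBA : B ≤ A := hB ▸ Ideal.mul_le_right
  have hCB : C ≤ B := hC ▸ Ideal.mul_le_right
  have hmA {y a : R} (hy : y ∈ maximalIdeal R) (ha : a ∈ A) : y * a ∈ B :=
    hB ▸ Ideal.mul_mem_mul hy ha
  have hmB {y b : R} (hy : y ∈ maximalIdeal R) (hb : b ∈ B) : y * b ∈ C :=
    hC ▸ Ideal.mul_mem_mul hy hb
  have hlt (C : Ideal R) {p : R} (hp : p ∉ C) : C < Ideal.span {p} ⊔ C :=
    lt_of_le_of_ne le_sup_right fun h =>
      hp (h ▸ Ideal.mem_sup_left (Ideal.mem_span_singleton_self p))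
  have hsle {B C : Ideal R} (h : C ≤ B) {p : R} (hp : p ∈ B) : Ideal.span {p} ⊔ C ≤ B :=
    sup_le ((Ideal.span_singleton_le_iff_mem _).2 hp) h
  have hself (C : Ideal R) (p : R) : p ∈ Ideal.span {p} ⊔ C :=
    Ideal.mem_sup_left (Ideal.mem_span_singleton_self p)
  -- two independent elements of `B / C` span
  have hspan {p q : R} (hp : p ∈ B) (hq : q ∈ B) (hpC : p ∉ C) (hqp : q ∉ Ideal.span {p} ⊔ C) :
      Ideal.span {q} ⊔ (Ideal.span {p} ⊔ C) = B :=
    hB₂ _ _ (hlt C hpC) (hlt _ hqp) (hsle (hsle hCB hp) hq)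
  have hexch {p w : R} (hw : w ∈ B) (hp : p ∉ C) (hpw : p ∈ Ideal.span {w} ⊔ C) :
      w ∈ Ideal.span {p} ⊔ C := by
    obtain ⟨a, c, hc, rfl⟩ := Ideal.mem_span_singleton_sup.1 hpw
    by_cases ha : IsUnit a
    · obtain ⟨u, rfl⟩ := ha
      exact Ideal.mem_span_singleton_sup.2 ⟨↑u⁻¹, -(↑u⁻¹ * c), C.neg_mem (C.mul_mem_left _ hc), by
        rw [mul_add, ← mul_assoc, Units.inv_mul]; ring⟩
    · exact absurd (C.add_mem (hmB ((mem_maximalIdeal a).2 ha) hw) hc) hp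
  by_contra! hbad
  -- no `z ∈ m` acts injectively from `A / B` to `B / C`
  have hgood {z v u : R} (hz : z ∈ maximalIdeal R) (hv : v ∈ A) (hu : u ∈ A) (hzv : z * v ∉ C) :
      z * u ∈ Ideal.span {z * v} ⊔ C := by
    by_contra hzu
    have hzA {a : R} (ha : a ∈ A) : z * a ∈ Ideal.span {z} * A ⊔ C :=
      Ideal.mem_sup_left (Ideal.mul_mem_mul (Ideal.mem_span_singleton_self z) ha)
    refine hbad z hz (le_antisymm (sup_le ?_ hCB) ?_)
    · exact hB ▸ Ideal.mul_mono_left ((Ideal.span_singleton_le_iff_mem _).2 hz)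
    · rw [← hspan (hmA hz hv) (hmA hz hu) hzv hzu]
      exact hsle (hsle le_sup_right (hzA hv)) (hzA hu)
  have hBC : ¬ B ≤ C := fun h => hB₁ 0 B.zero_mem (by simpa using le_antisymm hCB h)
  obtain ⟨z, hz, u, hu, hzu⟩ : ∃ z ∈ maximalIdeal R, ∃ u ∈ A, z * u ∉ C := by
    by_contra! h
    exact hBC (hB ▸ Ideal.mul_le.2 h)
  have hw := hmA hz hu
  have huB : u ∉ B := fun h => hzu (hmB hz h)
  obtain ⟨v', hv', hvu⟩ : ∃ v ∈ A, v ∉ Ideal.span {u} ⊔ B :=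
    SetLike.not_le_iff_exists.1 fun h => hA₁ u hu (le_antisymm (hsle hBA hu) h)
  obtain ⟨r, c, hc, hrc⟩ := Ideal.mem_span_singleton_sup.1 (hgood hz hu hv' hzu)
  obtain ⟨v, hv, hvB, hzv, hA⟩ : ∃ v ∈ A, v ∉ B ∧ z * v ∈ C ∧
      A = Ideal.span {v} ⊔ (Ideal.span {u} ⊔ B) := by
    have hvu' : v' - r * u ∉ Ideal.span {u} ⊔ B := fun h => hvu <| by
      simpa using add_mem h (Ideal.mul_mem_left _ r (hself B u))
    have hv : v' - r * u ∈ A := sub_mem hv' (A.mul_mem_left r hu)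
    refine ⟨v' - r * u, hv, fun h => hvu' (Ideal.mem_sup_right h), ?_, ?_⟩
    · rwa [show z * (v' - r * u) = c by rw [mul_sub, ← hrc]; ring]
    · exact (hA₂ _ _ (hlt B huB) (hlt _ hvu') (hsle (hsle hBA hu) hv)).symm
  have hyv {y : R} (hy : y ∈ maximalIdeal R) : y * v ∈ Ideal.span {z * u} ⊔ C := by
    by_contra h
    have hyvC : y * v ∉ C := fun h' => h (Ideal.mem_sup_right h')
    have h1 := hgood hy hv hu hyvC
    have h2 : (z + y) * v ∉ C := fun h' => hyvC <| by
      simpa [add_mul] using sub_mem h' hzv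
    have h3 := hgood (add_mem hz hy) hv hu h2
    refine h (hexch (hmA hy hv) hzu ?_)
    have h4 : Ideal.span {(z + y) * v} ⊔ C ≤ Ideal.span {y * v} ⊔ C := by
      refine hsle le_sup_right ?_
      rw [add_mul]
      exact add_mem (Ideal.mem_sup_right hzv) (hself _ _)
    simpa [add_mul] using sub_mem (h4 h3) h1
  obtain ⟨y₁, hy₁, hy₁v⟩ : ∃ y ∈ maximalIdeal R, y * v ∉ C := by
    by_contra! h
    exact hvB (hcolon v hv h)
  have hle : Ideal.span {y₁ * v} ⊔ C ≤ Ideal.span {z * u} ⊔ C := hsle le_sup_right (hyv hy₁)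
  obtain ⟨y₂, hy₂, hy₂u⟩ : ∃ y ∈ maximalIdeal R, y * u ∉ Ideal.span {z * u} ⊔ C := by
    by_contra! h
    refine hB₁ _ hw (le_antisymm (hsle hCB hw) ?_)
    rw [← hB, Ideal.mul_le]
    intro y hy a ha
    rw [hA] at ha
    obtain ⟨s, b', hb', rfl⟩ := Ideal.mem_span_singleton_sup.1 ha
    obtain ⟨t, b, hb, rfl⟩ := Ideal.mem_span_singleton_sup.1 hb'
    rw [show y * (s * v + (t * u + b)) = s * (y * v) + (t * (y * u) + y * b) by ring]
    exact add_mem (Ideal.mul_mem_left _ _ (hyv hy)) (add_mem (Ideal.mul_mem_left _ _ (h y hy))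
      (Ideal.mem_sup_right (hmB hy hb)))
  have hy₁u := hle (hgood hy₁ hv hu hy₁v)
  have hy₂v : y₂ * v ∈ C := by
    by_contra h
    exact hy₂u (hsle le_sup_right (hyv hy₂) (hgood hy₂ hv hu h))
  have h1 : (y₁ + y₂) * v ∉ C := fun h => hy₁v <| by
    simpa [add_mul] using sub_mem h hy₂v
  have h2 := hsle le_sup_right (hyv (add_mem hy₁ hy₂)) (hgood (add_mem hy₁ hy₂) hv hu h1)
  exact hy₂u (by simpa [add_mul] using sub_mem h2 hy₁u)

end

section

variable {R : Type*} [CommRing R] [IsLocalRing R] [IsNoetherianRing R]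

/-- In multiplicity two, some `z ∈ m` generates a minimal reduction of `m`; it has colength two.
No hypothesis on the residue field is needed. -/
theorem exists_length_quotient_span_singleton_eq_two
    (hm : ∃ x ∈ maximalIdeal R, x ∈ nonZeroDivisors R) {N : ℕ}
    (he : ∀ n ≥ N, Module.length R (R ⧸ maximalIdeal R ^ (n + 1)) =
      Module.length R (R ⧸ maximalIdeal R ^ n) + 2) :
    ∃ z ∈ maximalIdeal R, z ∈ nonZeroDivisors R ∧
      Module.length R (R ⧸ Ideal.span {z}) = 2 := by
  obtain ⟨c, hc⟩ := exists_forall_colon_maximalIdeal_pow hm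
  obtain ⟨x, hxm, hx⟩ := hm
  set m := maximalIdeal R
  let n := N + c
  have hfin (k : ℕ) : Module.length R (R ⧸ m ^ k) ≠ ⊤ := length_quotient_ne_top_of_pow_le le_rfl
  have hnot {k : ℕ} (hk : N ≤ k) : ∀ v ∈ m ^ k, Ideal.span {v} ⊔ m ^ (k + 1) ≠ m ^ k := by
    intro v hv h
    have := length_quotient_le_length_quotient_sup_add_one (C := m ^ (k + 1)) (w := v)
      fun y hy => pow_succ' m k ▸ Ideal.mul_mem_mul hy hv
    rw [h, he k hk] at this
    have hk := hfin k
    generalize Module.length R (R ⧸ m ^ k) = δ at *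
    lift δ to ℕ using hk
    norm_cast at this
    omega
  obtain ⟨z, hzm, hz⟩ := exists_span_singleton_mul_sup_eq (A := m ^ n) (B := m ^ (n + 1))
    (C := m ^ (n + 2)) (pow_succ' m n).symm (pow_succ' m (n + 1)).symm
    (fun P Q => eq_of_lt_of_lt_of_le (he n (by omega)) (hfin n))
    (fun P Q => eq_of_lt_of_lt_of_le (he (n + 1) (by omega)) (hfin (n + 1)))
    (hnot (by omega)) (hnot (by omega)) (fun a _ => hc n (by omega) a)
  have hmul : Ideal.span {z} * m ^ n = m ^ (n + 1) := by
    refine le_antisymm (hz ▸ le_sup_left) (Submodule.le_of_le_smul_of_le_jacobson_bot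
      (IsNoetherian.noetherian _) (maximalIdeal_le_jacobson ⊥) ?_)
    rw [smul_eq_mul, ← pow_succ', hz]
  have hzR : z ∈ nonZeroDivisors R := by
    have hxn : x ^ (n + 1) ∈ Ideal.span {z} * m ^ n := hmul ▸ Ideal.pow_mem_pow hxm (n + 1)
    obtain ⟨b, -, hb⟩ := Ideal.mem_span_singleton_mul.1 hxn
    exact (mul_mem_nonZeroDivisors.1 (hb ▸ pow_mem hx (n + 1))).1
  refine ⟨z, hzm, hzR, ?_⟩
  have := length_quotient_span_singleton_mul hzR (m ^ n)
  rw [hmul, he n (by omega)] at this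
  exact (WithTop.add_left_cancel (hfin n) this).symm

theorem le_span_singleton_of_forall_mul_mem {z : R} (hzm : z ∈ maximalIdeal R)
    (hz : z ∈ nonZeroDivisors R) (hz₂ : Module.length R (R ⧸ Ideal.span {z}) = 2)
    {I : Ideal R} (hfin : Module.length R (R ⧸ I) ≠ ⊤)
    (hI : ∀ g ∈ I, Ideal.span {g} ≠ I) {x : R} (hx : x ∈ nonZeroDivisors R) (hxI : x ∈ I)
    (h : ∀ a : R, (∀ r ∈ maximalIdeal R, r * a ∈ Ideal.span {x} * I) → a ∈ Ideal.span {x}) :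
    I ≤ Ideal.span {z} := by
  have hI' : ∀ g ∈ I, ¬ I ≤ Ideal.span {g} ⊔ maximalIdeal R * I := fun g hg hle =>
    hI g hg <| le_antisymm ((Ideal.span_singleton_le_iff_mem _).2 hg) <|
      Submodule.le_of_le_smul_of_le_jacobson_bot (IsNoetherian.noetherian _)
        (maximalIdeal_le_jacobson ⊥) hle
  have hmul : maximalIdeal R * I = Ideal.span {z} * I := by
    obtain ⟨g, hg, hgm⟩ : ∃ g ∈ I, g ∉ maximalIdeal R * I :=
      SetLike.not_le_iff_exists.1 fun hle => hI' 0 I.zero_mem (by simpa using hle)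
    have hle : Ideal.span {z} * I ≤ maximalIdeal R * I :=
      Ideal.mul_mono_left ((Ideal.span_singleton_le_iff_mem _).2 hzm)
    by_contra hne
    have h₁ := length_quotient_add_one_le (lt_of_le_of_ne hle (Ne.symm hne))
    have h₂ := length_quotient_add_one_le (J := maximalIdeal R * I)
      (K := Ideal.span {g} ⊔ maximalIdeal R * I) (lt_of_le_of_ne le_sup_right fun h => hgm <|
        h ▸ Ideal.mem_sup_left (Ideal.mem_span_singleton_self g))
    have h₃ := length_quotient_add_one_le (J := Ideal.span {g} ⊔ maximalIdeal R * I) (K := I)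
      (lt_of_le_not_ge (sup_le ((Ideal.span_singleton_le_iff_mem _).2 hg) Ideal.mul_le_right)
        (hI' g hg))
    rw [length_quotient_span_singleton_mul hz, hz₂] at h₁
    have key : Module.length R (R ⧸ I) + 1 + 1 + 1 ≤ Module.length R (R ⧸ I) + 2 := by
      refine le_trans ?_ h₁
      gcongr
      refine le_trans ?_ h₂
      gcongr
    generalize Module.length R (R ⧸ I) = δ at *
    lift δ to ℕ using hfin
    norm_cast at key
    omega
  have hmem {r i : R} (hr : r ∈ maximalIdeal R) (hi : i ∈ I) : ∃ j ∈ I, z * j = r * i :=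
    Ideal.mem_span_singleton_mul.1 (hmul ▸ Ideal.mul_mem_mul hr hi)
  have hIm : I ≤ maximalIdeal R := le_maximalIdeal fun hT =>
    hI 1 (hT ▸ trivial) (hT ▸ Ideal.span_singleton_one)
  intro i hi
  obtain ⟨a, -, ha⟩ := hmem (hIm hxI) hi
  obtain ⟨b, rfl⟩ := Ideal.mem_span_singleton'.1 <| h a fun r hr => by
    obtain ⟨j, hj, hji⟩ := hmem hr hi
    refine Ideal.mem_span_singleton_mul.2 ⟨j, hj, ?_⟩
    refine (mul_cancel_left_mem_nonZeroDivisors hz).1 ?_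
    linear_combination x * hji - r * ha
  refine Ideal.mem_span_singleton'.2 ⟨b, (mul_cancel_left_mem_nonZeroDivisors hx).1 ?_⟩
  linear_combination ha

end

theorem eliasIdeal_iff {R : Type u} [CommRing R] [IsLocalRing R] [IsNoetherianRing R]
    {I : Ideal R} (hIm : I ≤ maximalIdeal R) (hfin : Module.length R (R ⧸ I) ≠ ⊤)
    {x : R} (hx : x ∈ nonZeroDivisors R) (hxI : x ∈ I) :
    EliasIdeal R I ↔
      ∀ a : R, (∀ r ∈ maximalIdeal R, r * a ∈ Ideal.span {x} * I) → a ∈ Ideal.span {x} := by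
  obtain ⟨e⟩ := nonempty_ext_one_linearEquiv_s12 (ModuleCat.of R (ResidueField R))
    (ModuleCat.of R I) (x := x)
    (fun a b h => Subtype.ext <| (mul_cancel_left_mem_nonZeroDivisors hx).1 <|
      congrArg Subtype.val h)
    (fun y => by
      obtain ⟨r, rfl⟩ := residue_surjective y
      change residue R (x * r) = 0
      rw [residue_eq_zero_iff]
      exact Ideal.mul_mem_right _ _ (hIm hxI))
  rw [← length_hom_eq_iff hx hxI hIm hfin, EliasIdeal, idealType, modType, quotType, rlength,
    rlength, ← Module.coe_length, ← Module.coe_length, WithBot.coe_inj, e.length_eq]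

theorem elias_iff_le_principal_of_mult_two (R : Type u) [CommRing R] [IsLocalRing R] [IsNoetherianRing R]
    (hdim : ringKrullDim R = 1)
    (hCM : ∃ x ∈ maximalIdeal R, x ∈ nonZeroDivisors R)
    [Infinite (ResidueField R)] (he : HasMultiplicity R 2)
    (I : Ideal R) (hI : IsMPrimary R I) :
    EliasIdeal R I ↔
      ∃ x ∈ maximalIdeal R, x ∈ nonZeroDivisors R ∧ I ≤ Ideal.span {x} := by
  have hIm : I ≤ maximalIdeal R := Ideal.le_radical.trans_eq hI
  have hfin : Module.length R (R ⧸ I) ≠ ⊤ := by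
    obtain ⟨c, hc⟩ := Ideal.exists_radical_pow_le_of_fg I (IsNoetherian.noetherian _)
    exact length_quotient_ne_top_of_pow_le (hI ▸ hc)
  obtain ⟨x, hxI, hx⟩ : ∃ x ∈ I, x ∈ nonZeroDivisors R := by
    obtain ⟨x, hxm, hx⟩ := hCM
    obtain ⟨n, hn⟩ : x ∈ I.radical := hI ▸ hxm
    exact ⟨x ^ n, hn, pow_mem hx n⟩
  rw [eliasIdeal_iff hIm hfin hx hxI]
  constructor
  · intro h
    by_cases hprin : ∃ g ∈ I, Ideal.span {g} = I
    · obtain ⟨g, hg, rfl⟩ := hprin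
      obtain ⟨b, rfl⟩ := Ideal.mem_span_singleton'.1 hxI
      exact ⟨g, hIm hg, (mul_mem_nonZeroDivisors.1 hx).2, le_rfl⟩
    · push Not at hprin
      obtain ⟨N, hN⟩ := he
      obtain ⟨z, hzm, hz, hz₂⟩ := exists_length_quotient_span_singleton_eq_two hCM
        (N := N) fun n hn => by
          have := hN n hn
          rw [rlength, rlength, ← Module.coe_length, ← Module.coe_length] at this
          exact WithBot.coe_inj.1 this
      exact ⟨z, hzm, hz, le_span_singleton_of_forall_mul_mem hzm hz hz₂ hfin hprin hx hxI h⟩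
  · rintro ⟨y, hym, hy, hIy⟩ a ha
    obtain ⟨i, hi, hia⟩ := Ideal.mem_span_singleton_mul.1 (ha y hym)
    obtain ⟨c, rfl⟩ := Ideal.mem_span_singleton'.1 (hIy hi)
    refine Ideal.mem_span_singleton'.2 ⟨c, (mul_cancel_left_mem_nonZeroDivisors hy).1 ?_⟩
    linear_combination hia
end
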